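/- arXiv:1011.3009 — 3 statements merged into one kernel-verified Lean document; each statement's English description precedes it below -/
import Mathlib

section
/- Let B_1 denote the quotient ring I_1/F, let p ∈ K[T] be a nonconstant polynomial, and let ā ∈ B_1 denote the image of p(H). Then there exist a nonzero scalar ν ∈ K and a nonzero element b ∈ B_1 with āb − bā = ν·b if and only if deg p = 1. (Equivalently: the inner derivation ad(ā) of B_1 has a nonzero eigenvalue if and only if ā = λH̄ + μ with λ ∈ K nonzero.) -/
set_option linter.unusedSectionVars false

open Polynomial

noncomputable section

variable (K : Type*) [Field K] [CharZero K]

/-- Formal differentiation `∂` as a `K`-linear endomorphism of `K[x]`. -/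
def derOp : Module.End K (Polynomial K) := Polynomial.derivative

/-- Multiplication by `x` as a `K`-linear endomorphism of `K[x]`. -/
def xOp : Module.End K (Polynomial K) := LinearMap.mulLeft K (Polynomial.X : Polynomial K)

/-- Integration `∫`: the unique `K`-linear map with `∫ xⁿ = xⁿ⁺¹/(n+1)`. -/
def intOp : Module.End K (Polynomial K) :=
  Polynomial.lsum fun n => ((n : K) + 1)⁻¹ • Polynomial.monomial (n + 1)

/-- The algebra `I₁` of polynomial integro-differential operators: the unital
`K`-subalgebra of `End_K K[x]` generated by `X`, `∂` and `∫`. -/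
def I1 : Subalgebra K (Module.End K (Polynomial K)) :=
  Algebra.adjoin K {xOp K, derOp K, intOp K}

/-- `H := ∂ ∘ X`. -/
def Hop : Module.End K (Polynomial K) := derOp K * xOp K

/-- `e_{ij} := ∫^i ∂^j - ∫^{i+1} ∂^{j+1}`. -/
def eOp (i j : ℕ) : Module.End K (Polynomial K) :=
  intOp K ^ i * derOp K ^ j - intOp K ^ (i + 1) * derOp K ^ (j + 1)

/-- `F`, the `K`-linear span of the `e_{ij}`. -/
def Fspan : Submodule K (Module.End K (Polynomial K)) :=
  Submodule.span K (Set.range fun p : ℕ × ℕ => eOp K p.1 p.2)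

lemma xOp_mem : xOp K ∈ I1 K := Algebra.subset_adjoin (by simp)
lemma derOp_mem : derOp K ∈ I1 K := Algebra.subset_adjoin (by simp)
lemma intOp_mem : intOp K ∈ I1 K := Algebra.subset_adjoin (by simp)
lemma Hop_mem : Hop K ∈ I1 K := mul_mem (derOp_mem K) (xOp_mem K)
lemma eOp_mem (i j : ℕ) : eOp K i j ∈ I1 K :=
  sub_mem (mul_mem (pow_mem (intOp_mem K) i) (pow_mem (derOp_mem K) j))
    (mul_mem (pow_mem (intOp_mem K) (i + 1)) (pow_mem (derOp_mem K) (j + 1)))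

/-- `H` as an element of `I₁`. -/
def HelI : I1 K := ⟨Hop K, Hop_mem K⟩
/-- `∂` as an element of `I₁`. -/
def DelI : I1 K := ⟨derOp K, derOp_mem K⟩
/-- `∫` as an element of `I₁`. -/
def IntI : I1 K := ⟨intOp K, intOp_mem K⟩

lemma der_mono (n : ℕ) : derOp K (monomial n 1) = monomial (n - 1) (n : K) := by
  simp [derOp, derivative_monomial]

lemma x_mono (n : ℕ) : xOp K (monomial n 1) = monomial (n + 1) 1 := by
  simp [xOp, X_mul_monomial]

lemma int_mono (n : ℕ) : intOp K (monomial n 1) = monomial (n + 1) ((n : K) + 1)⁻¹ := by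
  simp [intOp, lsum_apply, sum_monomial_index, smul_monomial]

lemma mono_eq (n : ℕ) (a : K) : monomial n a = a • (monomial n (1 : K)) := by
  simp [smul_monomial]

lemma H_mono (n : ℕ) : Hop K (monomial n 1) = ((n : K) + 1) • monomial n (1 : K) := by
  rw [Hop, Module.End.mul_apply, x_mono, der_mono, ← mono_eq]
  simp

lemma aeval_H_mono (p : K[X]) (n : ℕ) :
    aeval (Hop K) p (monomial n (1 : K)) = p.eval ((n : K) + 1) • monomial n (1 : K) :=
  Module.End.aeval_apply_of_hasEigenvector (f := Hop K) (p := p) (μ := (n : K) + 1)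
    ⟨Module.End.mem_eigenspace_iff.2 (H_mono K n), by simp⟩

lemma int_pow_one (i : ℕ) : ∃ c : K, c ≠ 0 ∧
    (intOp K ^ i) (monomial 0 (1 : K)) = monomial i c := by
  induction i with
  | zero => exact ⟨1, one_ne_zero, by simp⟩
  | succ i ih =>
    obtain ⟨c, hc, h⟩ := ih
    refine ⟨c * ((i : K) + 1)⁻¹, mul_ne_zero hc (inv_ne_zero (Nat.cast_add_one_ne_zero i)), ?_⟩
    rw [pow_succ', Module.End.mul_apply, h, mono_eq, map_smul, int_mono, smul_monomial, smul_eq_mul]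

lemma der_pow (j n : ℕ) : (derOp K ^ j) (monomial n (1 : K)) =
    monomial (n - j) (n.descFactorial j : K) := by
  induction j with
  | zero => simp
  | succ j ih =>
    rw [pow_succ', Module.End.mul_apply, ih, mono_eq, map_smul, der_mono, smul_monomial,
      smul_eq_mul, Nat.descFactorial_succ, Nat.sub_sub]
    push_cast
    rw [mul_comm]

lemma eOp_eq (i j : ℕ) :
    eOp K i j = intOp K ^ i * ((1 - intOp K * derOp K) * derOp K ^ j) := by
  rw [eOp, pow_succ, pow_succ']
  rw [sub_mul, one_mul, mul_sub, mul_assoc, mul_assoc]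

lemma E_mono_zero (a : K) : (1 - intOp K * derOp K) (monomial 0 a) = monomial 0 a := by
  rw [mono_eq, map_smul, LinearMap.sub_apply, Module.End.mul_apply, der_mono]
  simp

lemma E_mono_succ (n : ℕ) (a : K) : (1 - intOp K * derOp K) (monomial (n + 1) a) = 0 := by
  have h : (n : K) + 1 ≠ 0 := Nat.cast_add_one_ne_zero n
  rw [mono_eq, map_smul, LinearMap.sub_apply, Module.End.mul_apply, der_mono, mono_eq K (n + 1 - 1),
    map_smul, Nat.add_sub_cancel, int_mono, smul_monomial]
  simp [h]

lemma eOp_ne (i j n : ℕ) (h : n ≠ j) : eOp K i j (monomial n 1) = 0 := by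
  rw [eOp_eq, Module.End.mul_apply, Module.End.mul_apply, der_pow]
  rcases lt_or_gt_of_ne h with h | h
  · rw [Nat.descFactorial_eq_zero_iff_lt.2 h]; simp
  · obtain ⟨k, rfl⟩ := Nat.exists_eq_add_of_lt h
    rw [show j + k + 1 - j = k + 1 by omega, E_mono_succ, map_zero]

lemma eOp_self (i j : ℕ) : ∃ c : K, c ≠ 0 ∧ eOp K i j (monomial j 1) = monomial i c := by
  obtain ⟨c, hc, h⟩ := int_pow_one K i
  refine ⟨(j.factorial : K) * c, mul_ne_zero (Nat.cast_ne_zero.2 j.factorial_ne_zero) hc, ?_⟩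
  rw [eOp_eq, Module.End.mul_apply, Module.End.mul_apply, der_pow, Nat.sub_self, E_mono_zero,
    Nat.descFactorial_self, mono_eq, map_smul, h, smul_monomial, smul_eq_mul]

lemma F_vanish (T : Module.End K K[X]) (hT : T ∈ Fspan K) :
    ∃ M : ℕ, ∀ n, M ≤ n → T (monomial n 1) = 0 := by
  induction hT using Submodule.span_induction with
  | mem x h =>
    obtain ⟨⟨i, j⟩, rfl⟩ := h
    exact ⟨j + 1, fun n hn => eOp_ne K i j n (by omega)⟩
  | zero => exact ⟨0, by simp⟩
  | add x y _ _ hx hy =>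
    obtain ⟨M, hM⟩ := hx
    obtain ⟨M', hM'⟩ := hy
    exact ⟨M + M', fun n hn => by simp [hM n (by omega), hM' n (by omega)]⟩
  | smul a x _ hx =>
    obtain ⟨M, hM⟩ := hx
    exact ⟨M, fun n hn => by simp [hM n hn]⟩

lemma F_rank (j : ℕ) (q : K[X]) : ∃ S ∈ Fspan K, S (monomial j 1) = q ∧
    ∀ n, n ≠ j → S (monomial n 1) = 0 := by
  induction q using Polynomial.induction_on' with
  | add p q hp hq =>
    obtain ⟨S, hS, h1, h2⟩ := hp
    obtain ⟨S', hS', h1', h2'⟩ := hq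
    exact ⟨S + S', add_mem hS hS', by simp [h1, h1'], fun n hn => by simp [h2 n hn, h2' n hn]⟩
  | monomial i a =>
    obtain ⟨c, hc, h⟩ := eOp_self K i j
    refine ⟨(a * c⁻¹) • eOp K i j,
      Submodule.smul_mem _ _ (Submodule.subset_span ⟨(i, j), rfl⟩), ?_, fun n hn => ?_⟩
    · rw [LinearMap.smul_apply, h, smul_monomial, smul_eq_mul, inv_mul_cancel_right₀ hc]
    · rw [LinearMap.smul_apply, eOp_ne K i j n hn, smul_zero]

lemma vanish_F (M : ℕ) : ∀ (T : Module.End K K[X])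
    (_ : ∀ n, M ≤ n → T (monomial n 1) = 0), T ∈ Fspan K := by
  induction M with
  | zero =>
    intro T hT
    have : T = 0 := by
      apply Polynomial.lhom_ext'
      intro n
      ext1
      simpa using hT n (Nat.zero_le n)
    rw [this]; exact zero_mem _
  | succ M ih =>
    intro T hT
    obtain ⟨S, hS, h1, h2⟩ := F_rank K M (T (monomial M 1))
    have := ih (T - S) (fun n hn => by
      rcases eq_or_ne n M with rfl | h
      · simp [h1]
      · rw [LinearMap.sub_apply, hT n (by omega), h2 n h, sub_zero])
    simpa using add_mem this hS

lemma coeff_apply_ne (T : Module.End K K[X]) (q : K[X]) (m : ℕ) (h : (T q).coeff m ≠ 0) :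
    ∃ k, q.coeff k ≠ 0 ∧ (T (monomial k 1)).coeff m ≠ 0 := by
  by_contra! hc
  apply h
  conv_lhs => rw [q.as_sum_support]
  rw [map_sum, finsetSum_coeff]
  refine Finset.sum_eq_zero fun k hk => ?_
  rw [mono_eq, map_smul, coeff_smul, hc k (mem_support_iff.1 hk), smul_zero]

lemma banded (T : Module.End K K[X]) (hT : T ∈ I1 K) :
    ∃ N : ℕ, ∀ n m, (T (monomial n 1)).coeff m ≠ 0 → m ≤ n + N ∧ n ≤ m + N := by
  induction hT using Algebra.adjoin_induction with
  | mem x h =>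
    refine ⟨1, fun n m => ?_⟩
    rcases h with rfl | rfl | rfl
    · rw [x_mono, coeff_monomial]; split_ifs <;> simp <;> omega
    · rw [der_mono, coeff_monomial]; split_ifs <;> simp <;> omega
    · rw [int_mono, coeff_monomial]; split_ifs <;> simp <;> omega
  | algebraMap r =>
    refine ⟨0, fun n m => ?_⟩
    rw [Module.algebraMap_end_apply, coeff_smul, coeff_monomial]
    split_ifs <;> simp <;> omega
  | add x y _ _ hx hy =>
    obtain ⟨N, hN⟩ := hx
    obtain ⟨N', hN'⟩ := hy
    refine ⟨N + N', fun n m h => ?_⟩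
    rw [LinearMap.add_apply, coeff_add] at h
    by_cases h1 : (x (monomial n 1)).coeff m = 0
    · rw [h1, zero_add] at h
      have := hN' n m h
      omega
    · have := hN n m h1
      omega
  | mul x y _ _ hx hy =>
    obtain ⟨N, hN⟩ := hx
    obtain ⟨N', hN'⟩ := hy
    refine ⟨N + N', fun n m h => ?_⟩
    rw [Module.End.mul_apply] at h
    obtain ⟨k, h1, h2⟩ := coeff_apply_ne K x _ m h
    have := hN k m h2
    have := hN' n k h1
    omega

/-- A polynomial with a constant nonzero difference has degree one. -/
lemma poly_deg (p : K[X]) (ν d : K) (hν : ν ≠ 0) (S : Set ℕ) (hS : S.Infinite)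
    (h : ∀ n ∈ S, p.eval ((n : K) + d + 1) - p.eval ((n : K) + 1) = ν) : p.natDegree = 1 := by
  have hall : p.comp (X + C (d + 1)) - p.comp (X + C 1) - C ν = 0 := by
    apply Polynomial.eq_zero_of_infinite_isRoot
    refine (hS.image (f := fun n : ℕ => (n : K)) Nat.cast_injective.injOn).mono ?_
    rintro _ ⟨n, hn, rfl⟩
    simp only [Set.mem_ofPred_eq, IsRoot, eval_sub, eval_comp, eval_add, eval_X, eval_C]
    rw [← h n hn]; ring_nf
  have hx : ∀ x : K, p.eval (x + d) = p.eval x + ν := by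
    intro x
    have := congrArg (eval (x - 1)) hall
    simp only [eval_sub, eval_comp, eval_add, eval_X, eval_C, eval_zero, sub_add_cancel] at this
    rw [show x - 1 + (d + 1) = x + d by ring] at this
    linear_combination this
  have hd : d ≠ 0 := by
    rintro rfl
    have := hx 0
    simp at this
    exact hν this
  have hn : ∀ n : ℕ, p.eval (n * d) = p.eval 0 + n * ν := by
    intro n
    induction n with
    | zero => simp
    | succ n ih =>
      push_cast
      rw [add_mul, one_mul, hx, ih]; ring
  have hp : p - (C (ν / d) * X + C (p.eval 0)) = 0 := by
    apply Polynomial.eq_zero_of_infinite_isRoot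
    refine (Set.infinite_range_of_injective (f := fun n : ℕ => (n : K) * d)
      (fun a b hab => Nat.cast_injective (mul_right_cancel₀ hd hab))).mono ?_
    rintro _ ⟨n, rfl⟩
    simp only [Set.mem_ofPred_eq, IsRoot, eval_sub, eval_add, eval_mul, eval_X, eval_C, hn]
    field_simp
    ring
  rw [sub_eq_zero.1 hp]
  exact natDegree_linear (div_ne_zero hν hd)

lemma coe_aeval (p : K[X]) :
    ((aeval (HelI K) p : I1 K) : Module.End K K[X]) = aeval (Hop K) p := by
  exact (Polynomial.aeval_algHom_apply (I1 K).val (HelI K) p).symm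

lemma main_fwd (p : K[X]) (ν : K) (hν : ν ≠ 0) (T : Module.End K K[X]) (hT : T ∈ I1 K)
    (hTF : T ∉ Fspan K)
    (h : aeval (Hop K) p * T - T * aeval (Hop K) p - ν • T ∈ Fspan K) : p.natDegree = 1 := by
  obtain ⟨N, hN⟩ := banded K T hT
  obtain ⟨M, hM⟩ := F_vanish K _ h
  have hcoeff : ∀ (q : K[X]) (m : ℕ),
      (aeval (Hop K) p q).coeff m = p.eval ((m : K) + 1) * q.coeff m := by
    intro q m
    induction q using Polynomial.induction_on' with
    | add a b ha hb => rw [map_add, coeff_add, coeff_add, ha, hb, mul_add]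
    | monomial n a =>
      rw [mono_eq, map_smul, aeval_H_mono, smul_monomial, smul_monomial, smul_monomial,
        coeff_monomial, coeff_monomial]
      split_ifs with hh
      · subst hh; simp [mul_comm]
      · simp
  have key : ∀ n m, M ≤ n → (T (monomial n 1)).coeff m ≠ 0 →
      p.eval ((m : K) + 1) - p.eval ((n : K) + 1) = ν := by
    intro n m hn hne
    have := congrArg (fun q => coeff q m) (hM n hn)
    simp only [LinearMap.sub_apply, Module.End.mul_apply, LinearMap.smul_apply, coeff_sub,
      hcoeff, aeval_H_mono, map_smul, coeff_smul, smul_eq_mul, coeff_zero] at this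
    apply mul_right_cancel₀ hne
    linear_combination this
  have hinf : {n : ℕ | M ≤ n ∧ T (monomial n 1) ≠ 0}.Infinite := by
    intro hf
    obtain ⟨B, hB⟩ := hf.bddAbove
    apply hTF
    refine vanish_F K (B + M + 1) T fun n hn => ?_
    by_contra hc
    have := hB (show n ∈ {n : ℕ | M ≤ n ∧ T (monomial n 1) ≠ 0} from ⟨by omega, hc⟩)
    omega
  have hsub : {n : ℕ | M ≤ n ∧ T (monomial n 1) ≠ 0} ⊆ ⋃ k ∈ Finset.range (2 * N + 1),
      {n : ℕ | M ≤ n ∧ ∃ m, m + N = n + k ∧ (T (monomial n 1)).coeff m ≠ 0} := by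
    rintro n ⟨hn, hne⟩
    obtain ⟨m, hm⟩ : ∃ m, (T (monomial n 1)).coeff m ≠ 0 := by
      by_contra! hc
      exact hne (Polynomial.ext (by simpa using hc))
    have := hN n m hm
    simp only [Set.mem_iUnion, Finset.mem_range, Set.mem_ofPred_eq]
    exact ⟨m + N - n, by omega, hn, m, by omega, hm⟩
  obtain ⟨k, hk⟩ : ∃ k, {n : ℕ | M ≤ n ∧ ∃ m, m + N = n + k ∧
      (T (monomial n 1)).coeff m ≠ 0}.Infinite := by
    by_contra! hc
    exact hinf ((Set.Finite.biUnion (Finset.finite_toSet _)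
      (fun k _ => hc k)).subset hsub)
  refine poly_deg K p ν ((k : K) - N) hν _ hk ?_
  rintro n ⟨hn, m, hm, hne⟩
  have h1 := key n m hn hne
  have h2 : (m : K) + N = n + k := by exact_mod_cast hm
  rw [← h1, show (n : K) + (k - N) + 1 = m + 1 by linear_combination -h2]

lemma main_bwd (p : K[X]) (hp : p.natDegree = 1) :
    aeval (Hop K) p * intOp K - intOp K * aeval (Hop K) p - p.coeff 1 • intOp K = 0 := by
  apply Polynomial.lhom_ext'
  intro n
  ext1
  obtain ⟨a, b, hab⟩ : ∃ a b, p = C a * X + C b :=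
    ⟨_, _, Polynomial.eq_X_add_C_of_natDegree_le_one hp.le⟩
  simp only [LinearMap.comp_apply, LinearMap.sub_apply, Module.End.mul_apply,
    LinearMap.smul_apply, LinearMap.zero_apply, aeval_H_mono, map_smul, int_mono]
  rw [mono_eq, map_smul, aeval_H_mono, smul_comm, ← sub_smul, ← sub_smul, hab]
  simp
  ring_nf
  simp

lemma int_notMem : intOp K ∉ Fspan K := by
  intro h
  obtain ⟨M, hM⟩ := F_vanish K _ h
  have := hM M le_rfl
  rw [int_mono, monomial_eq_zero_iff] at this
  exact inv_ne_zero (Nat.cast_add_one_ne_zero M) this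

set_option synthInstance.maxHeartbeats 400000
set_option maxHeartbeats 1000000

/-- Let `B₁ := I₁/F` and let `ā ∈ B₁` be the image of `p(H)` for a
nonconstant polynomial `p`. Then `ad(ā)` has a nonzero eigenvalue (i.e. there are
`ν ≠ 0` and `b ≠ 0` in `B₁` with `āb - bā = ν•b`) if and only if `deg p = 1`. -/
theorem ad_image_polynomial_H_has_nonzero_eigenvalue_iff_deg_one
    (FI : TwoSidedIdeal (I1 K))
    (hFI : ∀ a : I1 K, a ∈ FI ↔ (a : Module.End K (Polynomial K)) ∈ Fspan K)
    (p : Polynomial K) (hp : 1 ≤ p.natDegree) :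
    (∃ ν : K, ν ≠ 0 ∧ ∃ b : FI.ringCon.Quotient, b ≠ 0 ∧
        RingCon.mk' FI.ringCon (Polynomial.aeval (HelI K) p) * b -
          b * RingCon.mk' FI.ringCon (Polynomial.aeval (HelI K) p) = ν • b) ↔
      p.natDegree = 1 := by
  have hq : ∀ a : I1 K, RingCon.mk' FI.ringCon a = 0 ↔
      (a : Module.End K (Polynomial K)) ∈ Fspan K := by
    intro a
    rw [← hFI, TwoSidedIdeal.mem_iff]
    exact RingCon.eq FI.ringCon
  have hq2 : ∀ (ν : K) (a : I1 K),
      RingCon.mk' FI.ringCon (Polynomial.aeval (HelI K) p) * RingCon.mk' FI.ringCon a -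
          RingCon.mk' FI.ringCon a * RingCon.mk' FI.ringCon (Polynomial.aeval (HelI K) p)
            = ν • RingCon.mk' FI.ringCon a ↔
      aeval (Hop K) p * (a : Module.End K (Polynomial K)) - a * aeval (Hop K) p - ν • (a : Module.End K (Polynomial K)) ∈ Fspan K := by
    intro ν a
    have h1 : ν • RingCon.mk' FI.ringCon a = RingCon.mk' FI.ringCon (ν • a) := rfl
    rw [h1, ← map_mul, ← map_mul, ← map_sub, ← sub_eq_zero, ← map_sub, hq]
    simp only [Subalgebra.coe_sub, Subalgebra.coe_mul, Subalgebra.coe_smul, coe_aeval]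
  constructor
  · rintro ⟨ν, hν, b, hb, h⟩
    obtain ⟨a, rfl⟩ := RingCon.mk'_surjective FI.ringCon b
    rw [Ne, hq] at hb
    rw [hq2] at h
    exact main_fwd K p ν hν a a.2 hb h
  · intro h
    refine ⟨p.coeff 1, ?_, RingCon.mk' FI.ringCon (IntI K), ?_, ?_⟩
    · rw [← h]
      exact leadingCoeff_ne_zero.2 (by rintro rfl; simp at h)
    · rw [Ne, hq]; exact int_notMem K
    · rw [hq2]
      have := main_bwd K p h
      change aeval (Hop K) p * intOp K - intOp K * aeval (Hop K) p - p.coeff 1 • intOp K ∈ _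
      rw [this]; exact zero_mem _
end
end

section
/- For an element a ∈ I_1, the K-vector space Cen_F(a) := { f ∈ F : af = fa } is infinite-dimensional over K if and only if there exist a polynomial p ∈ K[T] and an element f ∈ F such that a = p(H) + f (i.e., a ∈ K[H] + F). -/
set_option linter.unusedSectionVars false

open Polynomial

noncomputable section

variable (K : Type*) [Field K] [CharZero K]

set_option synthInstance.maxHeartbeats 400000
set_option maxHeartbeats 1000000

lemma my_c_der (q : Polynomial K) (i : ℕ) :
    (derOp K q).coeff i * (i.factorial : K) = q.coeff (i+1) * ((i+1).factorial : K) := by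
  simp only [derOp, Polynomial.coeff_derivative, Nat.factorial_succ]
  push_cast; ring

lemma my_int_zero (q : Polynomial K) : (intOp K q).coeff 0 = 0 := by
  simp only [intOp, Polynomial.lsum_apply, Polynomial.sum_def, Polynomial.finsetSum_coeff]
  apply Finset.sum_eq_zero
  intro n _
  simp [Polynomial.coeff_monomial]

lemma my_int_succ (q : Polynomial K) (i : ℕ) :
    (intOp K q).coeff (i+1) = ((i : K) + 1)⁻¹ * q.coeff i := by
  simp only [intOp, Polynomial.lsum_apply, Polynomial.sum_def, Polynomial.finsetSum_coeff]
  simp only [LinearMap.smul_apply, Polynomial.coeff_smul, Polynomial.coeff_monomial, smul_eq_mul,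
    add_left_inj]
  rw [Finset.sum_eq_single i]
  · simp
  · intro b _ hb; simp [hb]
  · intro h; simp [Polynomial.notMem_support_iff.mp h]

lemma my_c_int (q : Polynomial K) (i : ℕ) :
    (intOp K q).coeff (i+1) * ((i+1).factorial : K) = q.coeff i * (i.factorial : K) := by
  rw [my_int_succ, Nat.factorial_succ]
  have : (i : K) + 1 ≠ 0 := by exact_mod_cast Nat.succ_ne_zero i
  push_cast; field_simp

lemma my_c_derpow (j : ℕ) : ∀ (q : Polynomial K) (i : ℕ),
    ((derOp K ^ j) q).coeff i * (i.factorial : K) = q.coeff (i+j) * ((i+j).factorial : K) := by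
  induction j with
  | zero => intro q i; simp
  | succ j ih =>
    intro q i
    rw [pow_succ', Module.End.mul_apply, my_c_der, ih]
    rw [show i + 1 + j = i + (j+1) by ring]

lemma my_c_intpow (j : ℕ) : ∀ (q : Polynomial K) (i : ℕ),
    ((intOp K ^ j) q).coeff i * (i.factorial : K) =
      if i < j then 0 else q.coeff (i-j) * ((i-j).factorial : K) := by
  induction j with
  | zero => intro q i; simp
  | succ j ih =>
    intro q i
    rw [pow_succ', Module.End.mul_apply]
    cases i with
    | zero => simp [my_int_zero]
    | succ i => rw [my_c_int, ih]; simp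

lemma my_c_e (i j : ℕ) (q : Polynomial K) (m : ℕ) :
    (eOp K i j q).coeff m * (m.factorial : K) =
      if m = i then q.coeff j * (j.factorial : K) else 0 := by
  simp only [eOp, LinearMap.sub_apply, Module.End.mul_apply, Polynomial.coeff_sub, sub_mul,
    my_c_intpow, my_c_derpow]
  by_cases h : m < i
  · simp [h, show m < i + 1 by omega, show m ≠ i by omega]
  · by_cases h2 : m = i
    · subst h2; simp
    · simp only [h, h2, show ¬ m < i + 1 by omega, if_false]
      rw [show m - (i+1) + (j+1) = m - i + j by omega, sub_self]

lemma my_fac (m : ℕ) : (m.factorial : K) ≠ 0 := by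
  exact_mod_cast Nat.factorial_ne_zero m

lemma my_e_coeff (i j : ℕ) (q : Polynomial K) (m : ℕ) :
    (eOp K i j q).coeff m =
      if m = i then q.coeff j * (j.factorial : K) / (i.factorial : K) else 0 := by
  have := my_c_e K i j q m
  split_ifs at this ⊢ with h
  · subst h; rw [eq_div_iff (my_fac K m), this]
  · simpa [my_fac K m] using this

lemma my_F_bound (f : Module.End K (Polynomial K)) (hf : f ∈ Fspan K) :
    ∃ M : ℕ, ∀ n ≥ M, f (X ^ n) = 0 ∧ ∀ q, (f q).coeff n = 0 := by
  induction hf using Submodule.span_induction with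
  | mem x h =>
    obtain ⟨⟨i, j⟩, rfl⟩ := h
    refine ⟨i + j + 1, fun n hn => ⟨?_, ?_⟩⟩
    · ext m
      simp [my_e_coeff, Polynomial.coeff_X_pow, show j ≠ n by omega]
    · intro q
      simp [my_e_coeff, show n ≠ i by omega]
  | zero => exact ⟨0, by simp⟩
  | add x y _ _ hx hy =>
    obtain ⟨M, hM⟩ := hx
    obtain ⟨L, hL⟩ := hy
    refine ⟨max M L, fun n hn => ⟨?_, fun q => ?_⟩⟩
    · simp [(hM n (le_of_max_le_left hn)).1, (hL n (le_of_max_le_right hn)).1]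
    · simp [(hM n (le_of_max_le_left hn)).2, (hL n (le_of_max_le_right hn)).2]
  | smul c x _ hx =>
    obtain ⟨M, hM⟩ := hx
    exact ⟨M, fun n hn => ⟨by simp [(hM n hn).1], fun q => by simp [(hM n hn).2]⟩⟩

lemma my_end_ext (f g : Module.End K (Polynomial K)) (h : ∀ n, f (X ^ n) = g (X ^ n)) :
    f = g := by
  apply Polynomial.lhom_ext'
  intro n
  ext
  simp [Polynomial.monomial_one_right_eq_X_pow, h]

lemma my_F_of (f : Module.End K (Polynomial K)) (N : ℕ) (h : ∀ n ≥ N, f (X ^ n) = 0) :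
    f ∈ Fspan K := by
  have : f = ∑ j ∈ Finset.range N, ∑ i ∈ (f (X ^ j)).support,
      ((f (X ^ j)).coeff i * (i.factorial : K) / (j.factorial : K)) • eOp K i j := by
    apply my_end_ext
    intro n
    ext m
    simp only [LinearMap.sum_apply, LinearMap.smul_apply, Polynomial.finsetSum_coeff,
      Polynomial.coeff_smul, my_e_coeff, Polynomial.coeff_X_pow, smul_eq_mul]
    by_cases hn : n < N
    · rw [Finset.sum_eq_single n]
      · rw [Finset.sum_eq_single m]
        · have := my_fac K n
          have := my_fac K m
          simp; field_simp
        · intro b _ hb; simp [hb.symm]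
        · intro hm; simp [Polynomial.notMem_support_iff.mp hm]
      · intro b _ hb; simp [hb]
      · intro hm; simp [hn] at hm
    · rw [h n (by omega)]
      symm
      simp only [Polynomial.coeff_zero]
      apply Finset.sum_eq_zero
      intro j hj
      have : j ≠ n := by have := Finset.mem_range.mp hj; omega
      simp [this]
  rw [this]
  refine Submodule.sum_mem _ fun j _ => Submodule.sum_mem _ fun i _ => Submodule.smul_mem _ _ ?_
  exact Submodule.subset_span ⟨(i, j), rfl⟩

lemma my_H_coeff (q : Polynomial K) (i : ℕ) :
    (Hop K q).coeff i = ((i : K) + 1) * q.coeff i := by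
  have h : Hop K q = derivative (X * q) := rfl
  rw [h, Polynomial.coeff_derivative, Polynomial.coeff_X_mul]
  ring

lemma my_aeval_coeff (p : Polynomial K) : ∀ (q : Polynomial K) (i : ℕ),
    (Polynomial.aeval (Hop K) p q).coeff i = p.eval ((i : K) + 1) * q.coeff i := by
  induction p using Polynomial.induction_on' with
  | add p r hp hr => intro q i; simp [hp, hr]; ring
  | monomial n c =>
    have key : ∀ (n : ℕ) (q : Polynomial K) (i : ℕ),
        ((Hop K ^ n) q).coeff i = ((i : K) + 1) ^ n * q.coeff i := by
      intro n
      induction n with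
      | zero => intro q i; simp
      | succ n ih =>
        intro q i
        rw [pow_succ', Module.End.mul_apply, my_H_coeff, ih]; ring
    intro q i
    simp [Polynomial.aeval_monomial, Module.End.mul_apply, key]
    ring

lemma my_apply_coeff (g : Module.End K (Polynomial K)) (q : Polynomial K) (i M : ℕ)
    (hM : q.natDegree < M) :
    (g q).coeff i = ∑ l ∈ Finset.range M, q.coeff l * (g (X ^ l)).coeff i := by
  conv_lhs => rw [q.as_sum_range' M hM]
  simp [← Polynomial.smul_X_eq_monomial]

lemma my_key (A F : ℕ → ℕ → K) (k N M : ℕ) (hk : 1 ≤ k)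
    (hA1 : ∀ n ≥ N, A (n+k) n ≠ 0) (hA2 : ∀ i j, j + k < i → N + k ≤ i → A i j = 0)
    (hF : ∀ i j, (M ≤ i ∨ M ≤ j) → F i j = 0)
    (hc : ∀ i j, ∃ M0, ∀ L ≥ M0, ∑ l ∈ Finset.range L, A i l * F l j =
      ∑ l ∈ Finset.range L, F i l * A l j)
    (h0 : ∀ i j, i < N + k → j < N + k → F i j = 0) : ∀ i j, F i j = 0 := by
  have s1 : ∀ t i j, N ≤ i → M ≤ i + t → F i j = 0 := by
    intro t
    induction t with
    | zero => intro i j _ h; exact hF i j (Or.inl (by simpa using h))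
    | succ t ih =>
      intro i j hi hit
      obtain ⟨M0, h⟩ := hc (i+k) j
      have h := h (max M0 (i+1)) (le_max_left _ _)
      rw [Finset.sum_eq_single i, Finset.sum_eq_zero] at h
      · exact (mul_eq_zero.mp h).resolve_left (hA1 i hi)
      · intro l _
        rw [ih (i+k) l (by omega) (by omega), zero_mul]
      · intro l _ hl
        rcases lt_or_gt_of_ne hl with hl | hl
        · rw [hA2 _ _ (by omega) (by omega), zero_mul]
        · rw [ih l j (by omega) (by omega), mul_zero]
      · intro hm
        exact absurd (Finset.mem_range.mpr (by omega)) hm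
  have s2 : ∀ j i, F i j = 0 := by
    intro j
    induction j using Nat.strong_induction_on with
    | _ j ih =>
      intro i
      by_cases hj : j < N + k
      · by_cases hi : i < N + k
        · exact h0 i j hi hj
        · exact s1 M i j (by omega) (by omega)
      · obtain ⟨n, rfl⟩ : ∃ n, j = n + k := ⟨j - k, by omega⟩
        obtain ⟨M0, h⟩ := hc i n
        have h := h (max M0 (n+k+1)) (le_max_left _ _)
        symm at h
        rw [Finset.sum_eq_single (n+k), Finset.sum_eq_zero] at h
        · exact (mul_eq_zero.mp h).resolve_right (hA1 n (by omega))
        · intro l _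
          rw [ih n (by omega) l, mul_zero]
        · intro l _ hl
          rcases lt_or_gt_of_ne hl with hl | hl
          · rw [ih l hl, zero_mul]
          · rw [hA2 _ _ (by omega) (by omega), mul_zero]
        · intro hm
          exact absurd (Finset.mem_range.mpr (by omega)) hm
  exact fun i j => s2 j i

lemma my_findim (a : Module.End K (Polynomial K)) (k N : ℕ) (hk : 1 ≤ k)
    (h : ((∀ n ≥ N, (a (X ^ n)).coeff (n+k) ≠ 0) ∧
          (∀ i j, j + k < i → N + k ≤ i → (a (X ^ j)).coeff i = 0)) ∨
         ((∀ n ≥ N, (a (X ^ (n+k))).coeff n ≠ 0) ∧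
          (∀ i j, j + k < i → N + k ≤ i → (a (X ^ i)).coeff j = 0))) :
    FiniteDimensional K
        ↥(Fspan K ⊓ Subalgebra.toSubmodule
            (Subalgebra.centralizer K {a})) := by
  let φ : Module.End K (Polynomial K) →ₗ[K] (Fin (N+k) → Fin (N+k) → K) :=
    { toFun := fun f i j => (f (X ^ (j : ℕ))).coeff i
      map_add' := by intro f g; ext i j; simp
      map_smul' := by intro c f; ext i j; simp }
  apply FiniteDimensional.of_injective (φ.comp (Submodule.subtype _))
  refine (injective_iff_map_eq_zero _).mpr ?_
  rintro ⟨f, hfF, hfC⟩ hf0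
  have hcomm : a * f = f * a := by
    have := Subalgebra.mem_centralizer_iff K |>.mp hfC
    exact this a rfl
  obtain ⟨M, hM⟩ := my_F_bound K f hfF
  have h0 : ∀ i j, i < N + k → j < N + k → (f (X ^ j)).coeff i = 0 := by
    intro i j hi hj
    exact congrFun (congrFun hf0 ⟨i, hi⟩) ⟨j, hj⟩
  have hF : ∀ i j, (M ≤ i ∨ M ≤ j) → (f (X ^ j)).coeff i = 0 := by
    rintro i j (h | h)
    · exact (hM i h).2 _
    · rw [(hM j h).1]; simp
  have hc : ∀ i j, ∃ M0, ∀ L ≥ M0,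
      ∑ l ∈ Finset.range L, (f (X ^ j)).coeff l * (a (X ^ l)).coeff i =
      ∑ l ∈ Finset.range L, (a (X ^ j)).coeff l * (f (X ^ l)).coeff i := by
    intro i j
    refine ⟨max ((f (X ^ j)).natDegree + 1) ((a (X ^ j)).natDegree + 1), fun L hL => ?_⟩
    rw [← my_apply_coeff K a _ _ _ (by omega), ← my_apply_coeff K f _ _ _ (by omega)]
    exact congrArg (fun g : Module.End K (Polynomial K) => (g (X ^ j)).coeff i) hcomm
  have hz : ∀ i j, (f (X ^ j)).coeff i = 0 := by
    rcases h with ⟨h1, h2⟩ | ⟨h1, h2⟩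
    · refine my_key K (fun i j => (a (X ^ j)).coeff i) (fun i j => (f (X ^ j)).coeff i) k N M hk
        h1 h2 hF ?_ h0
      intro i j
      obtain ⟨M0, h⟩ := hc i j
      refine ⟨M0, fun L hL => ?_⟩
      simpa only [mul_comm] using h L hL
    · have := my_key K (fun i j => (a (X ^ i)).coeff j) (fun i j => (f (X ^ i)).coeff j) k N M hk
        h1 h2 (fun i j h => hF j i h.symm) ?_ (fun i j hi hj => h0 j i hj hi)
      · exact fun i j => this j i
      intro i j
      obtain ⟨M0, h⟩ := hc j i
      refine ⟨M0, fun L hL => ?_⟩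
      exact (h L hL).symm
  have : f = 0 := by
    apply my_end_ext
    intro n; ext m; simpa using hz m n
  exact Subtype.ext this

/-- eventually-polynomial band operators -/
def MyGood (a : Module.End K (Polynomial K)) : Prop :=
  ∃ (d N : ℕ) (p : ℤ → Polynomial K), (∀ k : ℤ, ((d : ℤ) < k ∨ k < -(d : ℤ)) → p k = 0) ∧
    ∀ n ≥ N, ∀ i : ℕ, (a (X ^ n)).coeff i * (i.factorial : K) =
      (n.factorial : K) * (p ((i : ℤ) - n)).eval (n : K)

lemma my_good_one : MyGood K 1 := by
  refine ⟨0, 0, fun k => if k = 0 then 1 else 0, ?_, ?_⟩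
  · intro k hk
    have : k ≠ 0 := by rintro rfl; simp at hk
    simp [this]
  · intro n _ i
    by_cases h : i = n
    · subst h; simp
    · have : (i : ℤ) - n ≠ 0 := by omega
      simp [Polynomial.coeff_X_pow, h, this]

lemma my_good_zero : MyGood K 0 :=
  ⟨0, 0, fun _ => 0, by simp, by simp⟩

lemma my_good_add (a b : Module.End K (Polynomial K)) (ha : MyGood K a) (hb : MyGood K b) :
    MyGood K (a + b) := by
  obtain ⟨d, N, p, h1, h2⟩ := ha
  obtain ⟨e, L, r, h3, h4⟩ := hb
  refine ⟨max d e, max N L, fun k => p k + r k, ?_, ?_⟩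
  · intro k hk
    simp only [h1 k (by omega), h3 k (by omega), add_zero]
  · intro n hn i
    simp only [LinearMap.add_apply, Polynomial.coeff_add, add_mul, Polynomial.eval_add, mul_add,
      h2 n (by omega), h4 n (by omega)]

lemma my_good_smul (c : K) (a : Module.End K (Polynomial K)) (ha : MyGood K a) :
    MyGood K (c • a) := by
  obtain ⟨d, N, p, h1, h2⟩ := ha
  refine ⟨d, N, fun k => c • p k, ?_, ?_⟩
  · intro k hk; simp [h1 k hk]
  · intro n hn i
    simp only [LinearMap.smul_apply, Polynomial.coeff_smul, smul_eq_mul, mul_assoc, h2 n hn,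
      Polynomial.eval_smul]
    ring

lemma my_good_der (a : Module.End K (Polynomial K)) (ha : MyGood K a) :
    MyGood K (derOp K * a) := by
  obtain ⟨d, N, p, h1, h2⟩ := ha
  refine ⟨d + 1, N, fun k => p (k + 1), ?_, ?_⟩
  · intro k hk; exact h1 _ (by push_cast at hk; omega)
  · intro n hn i
    rw [Module.End.mul_apply, my_c_der, h2 n hn]
    rw [show ((i + 1 : ℕ) : ℤ) - n = (i : ℤ) - n + 1 by push_cast; ring]

lemma my_good_int (a : Module.End K (Polynomial K)) (ha : MyGood K a) :
    MyGood K (intOp K * a) := by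
  obtain ⟨d, N, p, h1, h2⟩ := ha
  refine ⟨d + 1, N + d, fun k => p (k - 1), ?_, ?_⟩
  · intro k hk; exact h1 _ (by push_cast at hk; omega)
  · intro n hn i
    cases i with
    | zero =>
      rw [Module.End.mul_apply, my_int_zero]; simp [h1 (-(n : ℤ) - 1) (by omega)]
    | succ i =>
      rw [Module.End.mul_apply, my_c_int, h2 n (by omega)]
      beta_reduce
      rw [show ((i + 1 : ℕ) : ℤ) - n - 1 = (i : ℤ) - n by push_cast; ring]

lemma my_good_x (a : Module.End K (Polynomial K)) (ha : MyGood K a) :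
    MyGood K (xOp K * a) := by
  obtain ⟨d, N, p, h1, h2⟩ := ha
  refine ⟨d + 1, N, fun k => (X + C (k : K)) * p (k - 1), ?_, ?_⟩
  · intro k hk; simp only [h1 (k-1) (by push_cast at hk; omega), mul_zero]
  · intro n hn i
    cases i with
    | zero => simp [Module.End.mul_apply, xOp]
    | succ i =>
      have : (xOp K (a (X ^ n))).coeff (i+1) = (a (X ^ n)).coeff i := by
        simp [xOp, Polynomial.coeff_X_mul]
      rw [Module.End.mul_apply, this, Nat.factorial_succ]
      have h := h2 n hn i
      beta_reduce
      rw [show ((i + 1 : ℕ) : ℤ) - n - 1 = (i : ℤ) - n by push_cast; ring]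
      push_cast
      simp only [Polynomial.eval_mul, Polynomial.eval_add, Polynomial.eval_X, Polynomial.eval_C]
      linear_combination ((i : K) + 1) * h

lemma my_good_I1 (a : Module.End K (Polynomial K)) (ha : a ∈ I1 K) : MyGood K a := by
  have ha' : a ∈ Subalgebra.toSubmodule (I1 K) := ha
  rw [I1, Algebra.adjoin_eq_span] at ha'
  clear ha
  induction ha' using Submodule.span_induction with
  | mem x h =>
    induction h using Submonoid.closure_induction_left with
    | one => exact my_good_one K
    | mul_left x hx y _ hy =>
      simp only [Set.mem_insert_iff, Set.mem_singleton_iff] at hx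
      have hy := hy
      rcases hx with rfl | rfl | rfl
      · exact my_good_x K _ (by assumption)
      · exact my_good_der K _ (by assumption)
      · exact my_good_int K _ (by assumption)
  | zero => exact my_good_zero K
  | add x y _ _ hx hy => exact my_good_add K x y (by assumption) (by assumption)
  | smul c x _ hx => exact my_good_smul K c x (by assumption)

lemma my_nonroot (p : Polynomial K) (hp : p ≠ 0) :
    ∃ N : ℕ, ∀ n ≥ N, p.eval (n : K) ≠ 0 := by
  have hfin : {n : ℕ | p.eval (n : K) = 0}.Finite := by
    have : ({x : K | p.IsRoot x}).Finite := Polynomial.finite_setOf_isRoot hp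
    exact this.preimage (Nat.cast_injective.injOn)
  obtain ⟨B, hB⟩ := hfin.bddAbove
  refine ⟨B + 1, fun n hn h => ?_⟩
  have := hB h
  omega

lemma my_forward (a : Module.End K (Polynomial K)) (ha : MyGood K a)
    (hinf : ¬ FiniteDimensional K
        ↥(Fspan K ⊓ Subalgebra.toSubmodule (Subalgebra.centralizer K {a}))) :
    ∃ (p : Polynomial K) (f : Module.End K (Polynomial K)), f ∈ Fspan K ∧
        a = Polynomial.aeval (Hop K) p + f := by
  obtain ⟨d, N, p, h1, h2⟩ := ha
  have hne : ∀ n ≥ N, ∀ i : ℕ, (p ((i : ℤ) - n)).eval (n : K) ≠ 0 → (a (X ^ n)).coeff i ≠ 0 := by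
    intro n hn i h h'
    have := h2 n hn i
    rw [h', zero_mul] at this
    exact (mul_ne_zero (my_fac K n) h) this.symm
  have heq : ∀ n ≥ N, ∀ i : ℕ, p ((i : ℤ) - n) = 0 → (a (X ^ n)).coeff i = 0 := by
    intro n hn i h
    have := h2 n hn i
    rw [h, Polynomial.eval_zero, mul_zero] at this
    exact (mul_eq_zero.mp this).resolve_right (my_fac K i)
  by_cases hpos : ∃ k : ℕ, 1 ≤ k ∧ p k ≠ 0
  · exfalso
    apply hinf
    classical
    obtain ⟨k, ⟨hk1, hk2⟩, hmax⟩ : ∃ k : ℕ, (1 ≤ k ∧ p k ≠ 0) ∧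
        ∀ l : ℕ, k < l → p l = 0 := by
      obtain ⟨k0, hk0⟩ := hpos
      have hb : ∀ k : ℕ, p k ≠ 0 → k ≤ d := by
        intro k hk
        by_contra hc
        exact hk (h1 k (by omega))
      have hsp := Nat.findGreatest_spec (P := fun k : ℕ => 1 ≤ k ∧ p k ≠ 0) (hb k0 hk0.2) hk0
      refine ⟨_, hsp, fun l hl => ?_⟩
      by_contra hc
      have := Nat.le_findGreatest (P := fun k : ℕ => 1 ≤ k ∧ p k ≠ 0) (hb l hc) ⟨by omega, hc⟩
      omega
    obtain ⟨R, hR⟩ := my_nonroot K _ hk2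
    let B := ∑ j ∈ Finset.range N, ((a (X ^ j)).natDegree + 1)
    refine my_findim K a k (N + R + B) hk1 (Or.inl ⟨?_, ?_⟩)
    · intro n hn
      apply hne n (by omega)
      rw [show ((n + k : ℕ) : ℤ) - n = k by push_cast; ring]
      exact hR n (by omega)
    · intro i j hij hi
      by_cases hj : N ≤ j
      · apply heq j hj
        have := hmax (i - j) (by omega)
        rwa [Nat.cast_sub (by omega)] at this
      · apply Polynomial.coeff_eq_zero_of_natDegree_lt
        have : (a (X ^ j)).natDegree + 1 ≤ B :=
          Finset.single_le_sum (f := fun j => (a (X ^ j)).natDegree + 1)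
            (fun _ _ => Nat.zero_le _) (Finset.mem_range.mpr (by omega))
        omega
  by_cases hneg : ∃ k : ℕ, 1 ≤ k ∧ p (-(k : ℤ)) ≠ 0
  · exfalso
    apply hinf
    classical
    obtain ⟨k, ⟨hk1, hk2⟩, hmax⟩ : ∃ k : ℕ, (1 ≤ k ∧ p (-(k : ℤ)) ≠ 0) ∧
        ∀ l : ℕ, k < l → p (-(l : ℤ)) = 0 := by
      obtain ⟨k0, hk0⟩ := hneg
      have hb : ∀ k : ℕ, p (-(k : ℤ)) ≠ 0 → k ≤ d := by
        intro k hk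
        by_contra hc
        exact hk (h1 _ (by omega))
      have hsp := Nat.findGreatest_spec (P := fun k : ℕ => 1 ≤ k ∧ p (-(k : ℤ)) ≠ 0)
        (hb k0 hk0.2) hk0
      refine ⟨_, hsp, fun l hl => ?_⟩
      by_contra hc
      have := Nat.le_findGreatest (P := fun k : ℕ => 1 ≤ k ∧ p (-(k : ℤ)) ≠ 0)
        (hb l hc) ⟨by omega, hc⟩
      omega
    obtain ⟨R, hR⟩ := my_nonroot K _ hk2
    refine my_findim K a k (N + R) hk1 (Or.inr ⟨?_, ?_⟩)
    · intro n hn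
      apply hne (n + k) (by omega)
      rw [show (n : ℤ) - ((n + k : ℕ) : ℤ) = -(k : ℤ) by push_cast; ring]
      exact hR (n + k) (by omega)
    · intro i j hij hi
      apply heq i (by omega)
      have := hmax (i - j) (by omega)
      rw [Nat.cast_sub (by omega)] at this
      rwa [neg_sub] at this
  push Not at hpos hneg
  refine ⟨(p 0).comp (X - 1), a - Polynomial.aeval (Hop K) ((p 0).comp (X - 1)), ?_, by abel⟩
  apply my_F_of K _ N
  intro n hn
  ext i
  simp only [LinearMap.sub_apply, Polynomial.coeff_sub, my_aeval_coeff, Polynomial.coeff_X_pow]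
  by_cases hi : i = n
  · subst hi
    have := h2 i hn i
    rw [sub_self, mul_comm] at this
    have := mul_left_cancel₀ (my_fac K i) this
    simp [this]
  · have : p ((i : ℤ) - n) = 0 := by
      rcases lt_or_gt_of_ne hi with h | h
      · have := hneg (n - i) (by omega)
        rwa [Nat.cast_sub h.le, neg_sub] at this
      · have := hpos (i - n) (by omega)
        rwa [Nat.cast_sub h.le] at this
    simp [heq n hn i this, hi]

lemma my_backward (p : Polynomial K) (f : Module.End K (Polynomial K)) (hf : f ∈ Fspan K) :
    ¬ FiniteDimensional K
        ↥(Fspan K ⊓ Subalgebra.toSubmodule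
          (Subalgebra.centralizer K {Polynomial.aeval (Hop K) p + f})) := by
  intro hfd
  obtain ⟨M, hM⟩ := my_F_bound K f hf
  have hee : ∀ n q, eOp K n n q = (q.coeff n) • (X : Polynomial K) ^ n := by
    intro n q
    ext m
    have := my_fac K n
    rw [my_e_coeff]
    simp [Polynomial.coeff_X_pow, this]
  have hmem : ∀ n, eOp K (M + n) (M + n) ∈ Fspan K ⊓ Subalgebra.toSubmodule
          (Subalgebra.centralizer K {Polynomial.aeval (Hop K) p + f}) := by
    intro n
    refine ⟨Submodule.subset_span ⟨(M + n, M + n), rfl⟩, ?_⟩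
    apply (Subalgebra.mem_centralizer_iff K).mpr
    rintro _ rfl
    apply LinearMap.ext
    intro q
    ext m
    simp only [Module.End.mul_apply, hee, LinearMap.add_apply, map_smul, (hM (M+n) (by omega)).1,
      Polynomial.coeff_add, (hM (M+n) (by omega)).2, my_aeval_coeff, Polynomial.coeff_smul,
      Polynomial.coeff_X_pow, smul_eq_mul]
    by_cases h : m = M + n
    · subst h; simp; ring
    · simp [h]
  let v : ℕ → ↥(Fspan K ⊓ Subalgebra.toSubmodule
          (Subalgebra.centralizer K {Polynomial.aeval (Hop K) p + f})) := fun n => ⟨_, hmem n⟩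
  have hv : LinearIndependent K v := by
    apply LinearIndependent.of_comp (Submodule.subtype _)
    rw [linearIndependent_iff']
    intro s g hg i hi
    have := congrArg (fun u : Module.End K (Polynomial K) => (u (X ^ (M + i))).coeff (M + i)) hg
    simp only [v, Function.comp, Submodule.subtype_apply, LinearMap.sum_apply,
      LinearMap.smul_apply, Polynomial.finsetSum_coeff, hee, Polynomial.coeff_smul,
      Polynomial.coeff_X_pow, smul_eq_mul, LinearMap.zero_apply, Polynomial.coeff_zero] at this
    rw [Finset.sum_eq_single i] at this
    · simpa using this
    · intro b _ hb; simp [hb]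
    · intro h; exact absurd hi h
  exact not_finite_iff_infinite.mpr inferInstance hv.finite

/-- For `a ∈ I₁`, the space `Cen_F(a) = {f ∈ F : af = fa}` is
infinite-dimensional over `K` iff `a ∈ K[H] + F`. -/
theorem cenF_infiniteDimensional_iff_mem_KH_add_F (a : I1 K) :
    ¬ FiniteDimensional K
        ↥(Fspan K ⊓ Subalgebra.toSubmodule
            (Subalgebra.centralizer K {(a : Module.End K (Polynomial K))})) ↔
      ∃ (p : Polynomial K) (f : Module.End K (Polynomial K)), f ∈ Fspan K ∧
        (a : Module.End K (Polynomial K)) = Polynomial.aeval (Hop K) p + f := by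
  constructor
  · exact my_forward K a (my_good_I1 K a a.2)
  · rintro ⟨p, f, hf, ha⟩
    rw [ha]
    exact my_backward K p f hf

end
end

section
/- Let M be a nonzero left I_1-module of finite length, let a ∈ I_1, and let a_M : M → M be the K-linear map m ↦ a·m. Then the kernel of a_M is finite-dimensional over K if and only if a ∉ F, and the cokernel of a_M is finite-dimensional over K if and only if a ∉ F. -/
set_option linter.unusedSectionVars false

open Polynomial

noncomputable section

variable (K : Type*) [Field K] [CharZero K]

set_option synthInstance.maxHeartbeats 400000
set_option maxHeartbeats 1000000

/-- The action of `a ∈ I₁` on an `I₁`-module `M`, as a `K`-linear map `M → M`. -/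
def actMap (M : Type*) [AddCommGroup M] [Module K M] [Module (I1 K) M]
    [IsScalarTower K (I1 K) M] (a : I1 K) : M →ₗ[K] M where
  toFun m := a • m
  map_add' := smul_add a
  map_smul' c m := by
    simp only [RingHom.id_apply]
    rw [← algebraMap_smul (I1 K) c m, ← mul_smul, ← Algebra.commutes, mul_smul,
      algebraMap_smul]


section Abstract

variable {K}

structure Ctx (K : Type*) {A : Type*} [Field K] [Ring A] [Algebra K A] (D J H : A) : Prop where
  hDJ : D * J = 1
  hHJ : H * J = J * H + J
  hDH : D * H = H * D + D
  hE : H * (1 - J * D) = 1 - J * D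
  gen : Algebra.adjoin K {D, J, H} = ⊤

variable {A : Type*} [Ring A] [Algebra K A] {D J H : A}
variable {M : Type*} [AddCommGroup M] [Module K M] [Module A M] [IsScalarTower K A M]

variable (K M) in
/-- action of `a` as a linear map -/
def ac (a : A) : Module.End K M := Algebra.lsmul K K M a

lemma ac_apply (a : A) (m : M) : ac K M a m = a • m := rfl

lemma ac_mul (a b : A) : ac K M (a * b) = ac K M a * ac K M b := by
  ext m; simp [ac_apply, mul_smul]

namespace Ctx

lemma stable (c : Ctx K D J H) (N : Submodule K M) (hD : ∀ m ∈ N, D • m ∈ N)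
    (hJ : ∀ m ∈ N, J • m ∈ N) (hH : ∀ m ∈ N, H • m ∈ N) (a : A) : ∀ m ∈ N, a • m ∈ N := by
  have ha : a ∈ Algebra.adjoin K {D, J, H} := by rw [c.gen]; trivial
  induction ha using Algebra.adjoin_induction with
  | mem x hx =>
    rcases hx with rfl | rfl | rfl
    · exact hD
    · exact hJ
    · exact hH
  | algebraMap r => intro m hm; rw [algebraMap_smul]; exact N.smul_mem _ hm
  | add x y _ _ hx hy => intro m hm; rw [add_smul]; exact N.add_mem (hx m hm) (hy m hm)
  | mul x y _ _ hx hy => intro m hm; rw [mul_smul]; exact hx _ (hy m hm)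

lemma DJn (c : Ctx K D J H) (n : ℕ) : D ^ n * J ^ n = 1 := by
  induction n with
  | zero => simp
  | succ n ih =>
    rw [pow_succ, pow_succ', mul_assoc, ← mul_assoc D J, c.hDJ, one_mul, ih]

lemma HJn (c : Ctx K D J H) (n : ℕ) : H * J ^ n = J ^ n * (H + n) := by
  induction n with
  | zero => simp
  | succ n ih =>
    rw [pow_succ, ← mul_assoc, ih, mul_assoc, add_mul, c.hHJ, mul_assoc]
    congr 1
    rw [(Nat.cast_commute n J).eq]; push_cast; noncomm_ring

lemma HDn (c : Ctx K D J H) (n : ℕ) : H * D ^ n = D ^ n * (H - n) := by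
  induction n with
  | zero => simp
  | succ n ih =>
    have h : H * D = D * H - D := by rw [c.hDH]; simp
    rw [pow_succ, ← mul_assoc, ih, mul_assoc, sub_mul, h, mul_assoc]
    congr 1
    rw [(Nat.cast_commute n D).eq]; push_cast; noncomm_ring

lemma DE (c : Ctx K D J H) : D * (1 - J * D) = 0 := by
  rw [mul_sub, ← mul_assoc, c.hDJ]; simp

lemma EJ (c : Ctx K D J H) : (1 - J * D) * J = 0 := by
  rw [sub_mul, mul_assoc, c.hDJ]; simp

lemma EH (c : Ctx K D J H) : (1 - J * D) * H = 1 - J * D := by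
  have h : J * D * H = H * (J * D) := by
    rw [mul_assoc, c.hDH, mul_add, ← mul_assoc, ← mul_assoc, c.hHJ, add_mul]
  rw [sub_mul, one_mul, h]
  have := c.hE
  rwa [mul_sub, mul_one] at this

/-- `q(H)` moves past `J`. -/
lemma JqH (c : Ctx K D J H) (q : K[X]) :
    J * aeval H q = aeval H (q.comp (X - 1)) * J := by
  have h : J * H = (H - 1) * J := by rw [sub_mul, c.hHJ]; simp
  induction q using Polynomial.induction_on' with
  | add p q hp hq => simp [mul_add, add_mul, hp, hq]
  | monomial n a =>
    simp only [aeval_monomial, monomial_comp, map_mul, aeval_C, map_pow, map_sub, aeval_X, map_one]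
    rw [← mul_assoc, ← Algebra.commutes, mul_assoc, mul_assoc]
    congr 1
    induction n with
    | zero => simp
    | succ n ih => rw [pow_succ, ← mul_assoc, ih, mul_assoc, h, pow_succ, mul_assoc]

lemma DqH (c : Ctx K D J H) (q : K[X]) :
    D * aeval H q = aeval H (q.comp (X + 1)) * D := by
  have h : D * H = (H + 1) * D := by rw [add_mul, c.hDH]; simp
  induction q using Polynomial.induction_on' with
  | add p q hp hq => simp [mul_add, add_mul, hp, hq]
  | monomial n a =>
    simp only [aeval_monomial, monomial_comp, map_mul, aeval_C, map_pow, map_add, aeval_X, map_one]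
    rw [← mul_assoc, ← Algebra.commutes, mul_assoc, mul_assoc]
    congr 1
    induction n with
    | zero => simp
    | succ n ih => rw [pow_succ, ← mul_assoc, ih, mul_assoc, h, pow_succ, mul_assoc]

lemma HqJ (c : Ctx K D J H) (q : K[X]) :
    H * aeval J q = aeval J q * H + aeval J (X * derivative q) := by
  induction q using Polynomial.induction_on' with
  | add p q hp hq => simp [mul_add, add_mul, hp, hq]; abel
  | monomial n a =>
    rw [aeval_monomial, ← mul_assoc, ← Algebra.commutes, mul_assoc, c.HJn, mul_assoc, mul_add,
      mul_add]
    congr 1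
    rw [derivative_monomial]
    cases n with
    | zero => simp
    | succ n =>
      simp [aeval_monomial, mul_assoc]
      congr 1
      simp [mul_add, add_mul, (Nat.cast_commute n _).eq]

end Ctx

/-- the ideal F -/
def FF (K : Type*) {A : Type*} [Field K] [Ring A] [Algebra K A] (D J : A) : Submodule K A :=
  Submodule.span K (Set.range fun p : ℕ × ℕ => J ^ p.1 * (1 - J * D) * D ^ p.2)

namespace Ctx

lemma FF_mem (i j : ℕ) : J ^ i * (1 - J * D) * D ^ j ∈ FF K D J :=
  Submodule.subset_span ⟨(i, j), rfl⟩

lemma FF_left (c : Ctx K D J H) (a : A) : ∀ f ∈ FF K D J, a * f ∈ FF K D J := by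
  refine c.stable (M := A) (FF K D J) ?_ ?_ ?_ a
  · intro m hm
    refine (Submodule.span_le (p := (FF K D J).comap (ac K A D))).2 ?_ hm
    rintro _ ⟨⟨i, j⟩, rfl⟩
    simp only [Submodule.comap_coe, Set.mem_preimage, SetLike.mem_coe, ac_apply, smul_eq_mul]
    cases i with
    | zero => simp [← mul_assoc, c.DE]
    | succ n =>
      rw [pow_succ', ← mul_assoc, ← mul_assoc, ← mul_assoc, c.hDJ, one_mul]
      exact FF_mem _ _
  · intro m hm
    refine (Submodule.span_le (p := (FF K D J).comap (ac K A J))).2 ?_ hm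
    rintro _ ⟨⟨i, j⟩, rfl⟩
    simp only [Submodule.comap_coe, Set.mem_preimage, SetLike.mem_coe, ac_apply, smul_eq_mul]
    rw [← mul_assoc, ← mul_assoc, ← pow_succ']
    exact FF_mem _ _
  · intro m hm
    refine (Submodule.span_le (p := (FF K D J).comap (ac K A H))).2 ?_ hm
    rintro _ ⟨⟨i, j⟩, rfl⟩
    simp only [Submodule.comap_coe, Set.mem_preimage, SetLike.mem_coe, ac_apply, smul_eq_mul]
    rw [← mul_assoc, ← mul_assoc, c.HJn, mul_assoc (J ^ i), add_mul, c.hE]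
    have : J ^ i * (1 - J * D + (i : A) * (1 - J * D)) * D ^ j
        = ((i : K) + 1) • (J ^ i * (1 - J * D) * D ^ j) := by
      rw [add_smul, one_smul, Nat.cast_smul_eq_nsmul, nsmul_eq_mul, mul_add, add_mul, add_comm]
      congr 1
      rw [← mul_assoc, ← mul_assoc, ← mul_assoc, (Nat.cast_commute i (J ^ i)).eq]
    rw [this]
    exact Submodule.smul_mem _ _ (FF_mem _ _)

lemma FF_right (c : Ctx K D J H) (a : A) : ∀ f ∈ FF K D J, f * a ∈ FF K D J := by
  have ha : a ∈ Algebra.adjoin K {D, J, H} := by rw [c.gen]; trivial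
  induction ha using Algebra.adjoin_induction with
  | mem x hx =>
    intro f hf
    refine (Submodule.span_le (p := (FF K D J).comap (LinearMap.mulRight K x))).2 ?_ hf
    rintro _ ⟨⟨i, j⟩, rfl⟩
    simp only [Submodule.comap_coe, Set.mem_preimage, SetLike.mem_coe, LinearMap.mulRight_apply]
    rcases hx with rfl | rfl | rfl
    · rw [mul_assoc, ← pow_succ]; exact FF_mem _ _
    · cases j with
      | zero => simp [mul_assoc, c.EJ]
      | succ n =>
        rw [pow_succ, mul_assoc, mul_assoc (D ^ n), c.hDJ, mul_one]
        exact FF_mem _ _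
    · have : D ^ j * x = (x + j) * D ^ j := by
        rw [add_mul, c.HDn, mul_sub, (Nat.cast_commute j (D ^ j)).eq]; simp
      rw [mul_assoc, this, ← mul_assoc, mul_add, mul_assoc (J ^ i), c.EH, add_mul]
      refine Submodule.add_mem _ (FF_mem _ _) ?_
      rw [← (Nat.cast_commute j _).eq, mul_assoc, ← nsmul_eq_mul]
      exact Submodule.smul_of_tower_mem _ _ (FF_mem _ _)
  | algebraMap r =>
    intro f hf; rw [← Algebra.commutes, ← Algebra.smul_def]; exact Submodule.smul_mem _ _ hf
  | add x y _ _ hx hy => intro m hm; rw [mul_add]; exact Submodule.add_mem _ (hx m hm) (hy m hm)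
  | mul x y _ _ hx hy => intro m hm; rw [← mul_assoc]; exact hy _ (hx m hm)

lemma E_mem : (1 - J * D) ∈ FF K D J := by simpa using FF_mem (K := K) (D := D) (J := J) 0 0

lemma JDn_mem (n : ℕ) : 1 - J ^ n * D ^ n ∈ FF K D J := by
  induction n with
  | zero => simp
  | succ n ih =>
    have : 1 - J ^ (n+1) * D ^ (n+1) = (1 - J ^ n * D ^ n) + J ^ n * (1 - J * D) * D ^ n := by
      rw [pow_succ, pow_succ']; noncomm_ring
    rw [this]
    exact Submodule.add_mem _ ih (FF_mem _ _)

/-- normal form -/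
lemma normal (c : Ctx K D J H) (a : A) :
    ∃ n : ℕ, ∃ w ∈ Algebra.adjoin K {J, H}, a - D ^ n * w ∈ FF K D J := by
  set W := Algebra.adjoin K {J, H} with hW
  have hJW : J ∈ W := Algebra.subset_adjoin (by simp)
  have hHW : H ∈ W := Algebra.subset_adjoin (by simp)
  have lift : ∀ a n, (∃ w ∈ W, a - D ^ n * w ∈ FF K D J) →
      ∀ k, ∃ w ∈ W, a - D ^ (n + k) * w ∈ FF K D J := by
    rintro a n ⟨w, hw, h⟩ k
    refine ⟨J ^ k * w, mul_mem (pow_mem hJW k) hw, ?_⟩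
    rwa [pow_add, mul_assoc, ← mul_assoc (D ^ k), c.DJn, one_mul]
  have key : ∀ b : A, (∃ n : ℕ, ∃ w ∈ W, b - D ^ n * w ∈ FF K D J) →
      ∃ n : ℕ, ∃ w ∈ W, a * b - D ^ n * w ∈ FF K D J := by
    have ha : a ∈ Algebra.adjoin K {D, J, H} := by rw [c.gen]; trivial
    induction ha using Algebra.adjoin_induction with
    | mem x hx =>
      rintro b ⟨n, w, hw, h⟩
      have h' := c.FF_left x _ h
      rcases hx with rfl | rfl | rfl
      · refine ⟨n + 1, w, hw, ?_⟩
        rwa [pow_succ', mul_assoc, ← mul_sub]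
      · cases n with
        | zero =>
          refine ⟨0, x * w, mul_mem hJW hw, ?_⟩
          simpa [mul_sub] using h'
        | succ n =>
          refine ⟨n, w, hw, ?_⟩
          have h2 := c.FF_right (D ^ n * w) _ E_mem
          have : x * b - D ^ n * w = x * (b - D ^ (n+1) * w) - (1 - x * D) * (D ^ n * w) := by
            rw [pow_succ']; noncomm_ring
          rw [this]
          exact Submodule.sub_mem _ h' h2
      · refine ⟨n, (x - n) * w, mul_mem (sub_mem hHW (natCast_mem _ n)) hw, ?_⟩
        rwa [← mul_assoc, ← c.HDn, mul_assoc, ← mul_sub]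
    | algebraMap r =>
      rintro b ⟨n, w, hw, h⟩
      refine ⟨n, r • w, W.smul_mem hw r, ?_⟩
      rw [mul_smul_comm, ← Algebra.smul_def, ← smul_sub]
      exact Submodule.smul_mem _ _ h
    | add x y _ _ hx hy =>
      intro b hb
      obtain ⟨n, h1⟩ := hx b hb
      obtain ⟨m, h2⟩ := hy b hb
      obtain ⟨w, hw, h1⟩ := lift _ _ h1 m
      obtain ⟨v, hv, h2⟩ := lift _ _ h2 n
      refine ⟨n + m, w + v, add_mem hw hv, ?_⟩
      rw [add_comm m n] at h2
      have := Submodule.add_mem _ h1 h2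
      convert this using 1
      noncomm_ring
    | mul x y _ _ hx hy =>
      intro b hb
      rw [mul_assoc]
      exact hx _ (hy b hb)
  simpa using key 1 ⟨0, 1, one_mem _, by simp⟩

lemma normal' (c : Ctx K D J H) (a : A) :
    ∃ n : ℕ, ∃ w ∈ Algebra.adjoin K {J, H}, J ^ n * a - w ∈ FF K D J ∧
      (a ∉ FF K D J → w ≠ 0) := by
  obtain ⟨n, w, hw, h⟩ := c.normal a
  refine ⟨n, w, hw, ?_, ?_⟩
  · have h1 := c.FF_left (J ^ n) _ h
    have h2 := c.FF_right w _ (JDn_mem n)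
    have := Submodule.sub_mem _ h1 h2
    convert this using 1
    noncomm_ring
  · rintro ha rfl
    apply ha
    simpa using h

end Ctx

/-- `Σ p_i(B) C^i` -/
def Phi (B C : A) (p : K[X][X]) : A := p.sum fun i q => aeval B q * C ^ i

lemma Phi_add (B C : A) (p q : K[X][X]) : Phi B C (p + q) = Phi B C p + Phi B C q :=
  Polynomial.sum_add_index _ _ _ (by simp) (by simp [add_mul])

lemma Phi_monomial (B C : A) (i : ℕ) (q : K[X]) :
    Phi B C (monomial i q) = aeval B q * C ^ i :=
  Polynomial.sum_monomial_index _ _ (by simp)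

lemma Phi_zero (B C : A) : Phi B C (0 : K[X][X]) = 0 := by simp [Phi]

lemma Phi_range (B C : A) (p : K[X][X]) :
    Phi B C p = ∑ i ∈ Finset.range (p.natDegree + 1), aeval B (p.coeff i) * C ^ i :=
  Polynomial.sum_over_range _ (by simp)

lemma Phi_form (B C : A) (hC : ∀ q : K[X], ∃ p : K[X][X], C * aeval B q = Phi B C p)
    (w : A) (hw : w ∈ Algebra.adjoin K {B, C}) : ∃ p : K[X][X], w = Phi B C p := by
  have hmulC : ∀ (p : K[X][X]) (i : ℕ), ∃ p' : K[X][X], Phi B C p * C ^ i = Phi B C p' := by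
    intro p i
    induction p using Polynomial.induction_on' with
    | add p q hp hq =>
      obtain ⟨p', hp⟩ := hp
      obtain ⟨q', hq⟩ := hq
      exact ⟨p' + q', by rw [Phi_add, Phi_add, add_mul, hp, hq]⟩
    | monomial n q => exact ⟨monomial (n + i) q, by
        rw [Phi_monomial, Phi_monomial, mul_assoc, pow_add]⟩
  have key : ∀ p : K[X][X], ∃ p' : K[X][X], w * Phi B C p = Phi B C p' := by
    induction hw using Algebra.adjoin_induction with
    | mem x hx =>
      intro p
      induction p using Polynomial.induction_on' with
      | add p q hp hq =>
        obtain ⟨p', hp⟩ := hp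
        obtain ⟨q', hq⟩ := hq
        exact ⟨p' + q', by rw [Phi_add, Phi_add, mul_add, hp, hq]⟩
      | monomial n q =>
        rcases hx with rfl | rfl
        · exact ⟨monomial n (X * q), by simp [Phi_monomial, mul_assoc]⟩
        · obtain ⟨p, hp⟩ := hC q
          rw [Phi_monomial, ← mul_assoc, hp]
          exact hmulC _ _
    | algebraMap r =>
      intro p
      induction p using Polynomial.induction_on' with
      | add p q hp hq =>
        obtain ⟨p', hp⟩ := hp
        obtain ⟨q', hq⟩ := hq
        exact ⟨p' + q', by rw [Phi_add, Phi_add, mul_add, hp, hq]⟩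
      | monomial n q => exact ⟨monomial n (Polynomial.C r * q), by simp [Phi_monomial, mul_assoc]⟩
    | add x y _ _ hx hy =>
      intro p
      obtain ⟨p', hp⟩ := hx p
      obtain ⟨q', hq⟩ := hy p
      exact ⟨p' + q', by rw [Phi_add, add_mul, hp, hq]⟩
    | mul x y _ _ hx hy =>
      intro p
      obtain ⟨p', hp⟩ := hy p
      obtain ⟨q', hq⟩ := hx p'
      exact ⟨q', by rw [mul_assoc, hp, hq]⟩
  obtain ⟨p, hp⟩ := key (monomial 0 1)
  exact ⟨p, by rw [← hp, Phi_monomial]; simp⟩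

namespace Ctx

/-- `Σ a_i(J) H^i` -/
lemma form1 (c : Ctx K D J H) (w : A) (hw : w ∈ Algebra.adjoin K {J, H}) :
    ∃ p : K[X][X], w = Phi J H p := by
  refine Phi_form J H (fun q => ?_) w hw
  exact ⟨monomial 1 q + monomial 0 (X * derivative q), by
    rw [c.HqJ, Phi_add, Phi_monomial, Phi_monomial]; simp⟩

/-- `Σ a_i(H) J^i` -/
lemma form2 (c : Ctx K D J H) (w : A) (hw : w ∈ Algebra.adjoin K {J, H}) :
    ∃ p : K[X][X], w = Phi H J p := by
  rw [Set.pair_comm] at hw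
  refine Phi_form H J (fun q => ?_) w hw
  exact ⟨monomial 1 (q.comp (X - 1)), by rw [c.JqH, Phi_monomial]; simp⟩

end Ctx


namespace Ctx

lemma JqH_smul_inj (c : Ctx K D J H) (m : M) (h : J • m = 0) : m = 0 := by
  rw [← one_smul A m, ← c.hDJ, mul_smul, h, smul_zero]

/-- no finite dimensional stable subspaces -/
lemma inf (c : Ctx K D J H) (N : Submodule K M) [FiniteDimensional K N]
    (hJ : ∀ m ∈ N, J • m ∈ N) (hH : ∀ m ∈ N, H • m ∈ N) : N = ⊥ := by
  let j : Module.End K N := (ac K M J).restrict hJ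
  let h : Module.End K N := (ac K M H).restrict hH
  have hj : Function.Injective j := by
    rw [← LinearMap.ker_eq_bot, LinearMap.ker_eq_bot']
    intro m hm
    have := c.JqH_smul_inj (m : M) (congrArg Subtype.val hm)
    exact Subtype.ext this
  let e : N ≃ₗ[K] N := LinearEquiv.ofInjectiveEndo j hj
  let i : Module.End K N := e.symm
  have hij : i * j = 1 := by
    ext m
    have : e.symm (e m) = m := e.symm_apply_apply m
    exact congrArg Subtype.val this
  have hji : j * i = 1 := by
    ext m
    have : e (e.symm m) = m := e.apply_symm_apply m
    exact congrArg Subtype.val this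
  have hrel : h * j = j * h + j := by
    ext m
    have : (H * J) • (m : M) = (J * H + J) • (m : M) := by rw [c.hHJ]
    rw [mul_smul, add_smul, mul_smul] at this
    exact this
  have e1 : LinearMap.trace K N h = LinearMap.trace K N (j * h * i) + LinearMap.trace K N 1 := by
    rw [← map_add]
    congr 1
    rw [← hji, ← add_mul, ← hrel, mul_assoc, hji, mul_one]
  rw [LinearMap.trace_mul_comm, ← mul_assoc, hij, one_mul, LinearMap.trace_one] at e1
  have : Module.finrank K N = 0 := by
    have : (Module.finrank K N : K) = 0 := by simpa using e1
    exact_mod_cast this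
  exact Submodule.finrank_eq_zero.1 this

lemma EbE (c : Ctx K D J H) (b : A) :
    ∃ k : K, (1 - J * D) * b * (1 - J * D) = k • (1 - J * D) := by
  let L : Submodule K A := Submodule.span K (Set.range fun i : ℕ => J ^ i * (1 - J * D))
  have hL : ∀ i, J ^ i * (1 - J * D) ∈ L := fun i => Submodule.subset_span ⟨i, rfl⟩
  have h1 : b • (1 - J * D) ∈ L := by
    refine c.stable L ?_ ?_ ?_ b _ (by simpa using hL 0)
    · intro m hm
      refine (Submodule.span_le (p := L.comap (ac K A D))).2 ?_ hm
      rintro _ ⟨i, rfl⟩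
      simp only [Submodule.comap_coe, Set.mem_preimage, SetLike.mem_coe, ac_apply, smul_eq_mul]
      cases i with
      | zero => simp [c.DE]
      | succ n =>
        rw [pow_succ', ← mul_assoc, ← mul_assoc, c.hDJ, one_mul]
        exact hL _
    · intro m hm
      refine (Submodule.span_le (p := L.comap (ac K A J))).2 ?_ hm
      rintro _ ⟨i, rfl⟩
      simp only [Submodule.comap_coe, Set.mem_preimage, SetLike.mem_coe, ac_apply, smul_eq_mul]
      rw [← mul_assoc, ← pow_succ']
      exact hL _
    · intro m hm
      refine (Submodule.span_le (p := L.comap (ac K A H))).2 ?_ hm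
      rintro _ ⟨i, rfl⟩
      simp only [Submodule.comap_coe, Set.mem_preimage, SetLike.mem_coe, ac_apply, smul_eq_mul]
      rw [← mul_assoc, c.HJn, mul_assoc (J ^ i), add_mul, c.hE, mul_add]
      refine L.add_mem (hL i) ?_
      rw [← mul_assoc, ← (Nat.cast_commute i (J ^ i)).eq, mul_assoc, ← nsmul_eq_mul]
      exact L.smul_of_tower_mem _ (hL i)
  have h2 : L ≤ (Submodule.span K {1 - J * D}).comap (ac K A (1 - J * D)) := by
    refine Submodule.span_le.2 ?_
    rintro _ ⟨i, rfl⟩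
    simp only [Submodule.comap_coe, Set.mem_preimage, SetLike.mem_coe, ac_apply, smul_eq_mul]
    cases i with
    | zero =>
      have : (1 - J * D) * (1 - J * D) = 1 - J * D := by
        rw [mul_sub, ← mul_assoc, c.EJ]; simp
      simp only [pow_zero, one_mul, this]
      exact Submodule.mem_span_singleton_self _
    | succ n => rw [pow_succ', ← mul_assoc, ← mul_assoc, c.EJ]; simp
  obtain ⟨k, hk⟩ := Submodule.mem_span_singleton.1 (h2 h1)
  exact ⟨k, by rw [hk]; simp [ac_apply, mul_assoc]⟩

lemma exists_gen (c : Ctx K D J H) [IsSimpleModule A M] :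
    ∃ m : M, m ≠ 0 ∧ (∃ p : K[X][X], p ≠ 0 ∧ Phi H J p • m = 0) ∧
      ∀ x : M, ∃ k : K, (1 - J * D) • x = k • m := by
  by_cases h : ∃ x : M, (1 - J * D) • x ≠ 0
  · obtain ⟨x, hx⟩ := h
    refine ⟨_, hx, ⟨monomial 0 (X - 1), ?_, ?_⟩, ?_⟩
    · rw [Ne, monomial_eq_zero_iff]; exact X_sub_C_ne_zero (1 : K)
    · rw [Phi_monomial, ← mul_smul]; simp [sub_mul, c.hE]
    · intro y
      obtain ⟨b, rfl⟩ := IsSimpleModule.toSpanSingleton_surjective A hx y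
      obtain ⟨k, hk⟩ := c.EbE b
      refine ⟨k, ?_⟩
      rw [LinearMap.toSpanSingleton_apply, ← mul_smul, ← mul_smul, hk, smul_assoc]
  · push Not at h
    have hF : ∀ f ∈ FF K D J, ∀ x : M, f • x = 0 := by
      intro f hf x
      refine Submodule.span_induction (p := fun f _ => f • x = 0) ?_ ?_ ?_ ?_ hf
      · rintro _ ⟨⟨i, j⟩, rfl⟩
        simp [mul_smul, h]
      · simp
      · intro a b _ _ ha hb; rw [add_smul, ha, hb, add_zero]
      · intro a b _ hb; rw [smul_assoc, hb, smul_zero]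
    have := IsSimpleModule.nontrivial A M
    obtain ⟨m, hm⟩ := exists_ne (0 : M)
    refine ⟨m, hm, ?_, fun x => ⟨0, by simp [h]⟩⟩
    by_cases h1 : (J - 1) • m = 0
    · refine ⟨monomial 1 1 + monomial 0 (-1), ?_, ?_⟩
      · intro h; have := congrArg (fun p => p.coeff 1) h
        simp [coeff_one] at this
      · rw [Phi_add, Phi_monomial, Phi_monomial]; simpa [sub_eq_add_neg] using h1
    · obtain ⟨b, hb⟩ := IsSimpleModule.toSpanSingleton_surjective A h1 m
      rw [LinearMap.toSpanSingleton_apply] at hb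
      obtain ⟨n, w, hw, h2, -⟩ := c.normal' b
      obtain ⟨p, rfl⟩ := c.form2 w hw
      have h3 : Phi H J p * (J - 1) = Phi H J (p * (X - 1)) := by
        clear h2 hw
        induction p using Polynomial.induction_on' with
        | add p q hp hq => rw [Phi_add, add_mul, hp, hq, add_mul, Phi_add]
        | monomial n q =>
          have : monomial n q * (X - 1 : K[X][X]) = monomial (n+1) q + monomial n (-q) := by
            rw [mul_sub, monomial_mul_X]; simp [sub_eq_add_neg]
          rw [this, Phi_add, Phi_monomial, Phi_monomial, Phi_monomial, mul_sub, mul_assoc, pow_succ]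
          simp [sub_eq_add_neg]
      refine ⟨monomial n (-1) + p * (X - 1), ?_, ?_⟩
      · intro h
        have := congrArg (fun p => p.eval 1) h
        simp at this
      · rw [Phi_add, Phi_monomial, ← h3]
        have h4 := hF _ h2 ((J - 1) • m)
        rw [sub_smul, mul_smul, hb, sub_eq_zero] at h4
        rw [add_smul, mul_smul (Phi H J p), ← h4]
        simp

lemma FF_range (c : Ctx K D J H) [IsSimpleModule A M] (f : A) (hf : f ∈ FF K D J) :
    FiniteDimensional K (LinearMap.range (ac K M f)) := by
  obtain ⟨m, -, -, hm⟩ := c.exists_gen (M := M)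
  refine Submodule.span_induction
    (p := fun f _ => FiniteDimensional K (LinearMap.range (ac K M f))) ?_ ?_ ?_ ?_ hf
  · rintro _ ⟨⟨i, j⟩, rfl⟩
    have : LinearMap.range (ac K M (J ^ i * (1 - J * D) * D ^ j)) ≤
        Submodule.span K {J ^ i • m} := by
      rintro _ ⟨x, rfl⟩
      obtain ⟨k, hk⟩ := hm (D ^ j • x)
      rw [ac_apply, mul_smul, mul_smul, hk, smul_comm]
      exact Submodule.smul_mem _ _ (Submodule.mem_span_singleton_self _)
    exact Submodule.finiteDimensional_of_le this
  · have : ac K M (0 : A) = 0 := by ext; simp [ac_apply]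
    rw [this, LinearMap.range_zero]; infer_instance
  · intro a b _ _ ha hb
    have : LinearMap.range (ac K M (a + b)) ≤ LinearMap.range (ac K M a) ⊔ LinearMap.range (ac K M b) := by
      rintro _ ⟨x, rfl⟩
      rw [ac_apply, add_smul]
      exact Submodule.add_mem_sup ⟨x, rfl⟩ ⟨x, rfl⟩
    exact Submodule.finiteDimensional_of_le this
  · intro r a _ ha
    have : LinearMap.range (ac K M (r • a)) ≤ LinearMap.range (ac K M a) := by
      rintro _ ⟨x, rfl⟩
      rw [ac_apply, smul_assoc]
      exact Submodule.smul_mem _ _ ⟨x, rfl⟩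
    exact Submodule.finiteDimensional_of_le this

end Ctx

/-- linear growth -/
def LG (K : Type*) {A : Type*} [Field K] [Ring A] [Algebra K A] (D J H : A)
    (M : Type*) [AddCommGroup M] [Module K M] [Module A M] : Prop :=
  ∃ (G : ℕ → Submodule K M) (C : ℕ), Monotone G ∧ (∀ n, FiniteDimensional K (G n)) ∧
    (∀ n, Module.finrank K (G n) ≤ C * (n + 1)) ∧ (∀ x, ∃ n, x ∈ G n) ∧
    (∀ n, ∀ x ∈ G n, D • x ∈ G (n + 1) ∧ J • x ∈ G (n + 1) ∧ H • x ∈ G (n + 1))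

/-- span of the monomials of weight < n -/
def VV (K : Type*) {A : Type*} [Field K] [Ring A] [Algebra K A] (J H : A)
    {M : Type*} [AddCommGroup M] [Module K M] [Module A M] (m : M) (L n : ℕ) : Submodule K M :=
  Submodule.span K {x | ∃ i j : ℕ, j + L * i < n ∧ x = (H ^ j * J ^ i) • m}

lemma VV_mono (m : M) (L : ℕ) : Monotone (VV K J H m L) := by
  intro a b hab
  refine Submodule.span_mono ?_
  rintro _ ⟨i, j, h, rfl⟩
  exact ⟨i, j, by omega, rfl⟩

lemma VV_poly (m : M) (L n i k : ℕ) (q : K[X]) (hq : q.natDegree ≤ k) (h : k + L * i < n) :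
    (aeval H q * J ^ i) • m ∈ VV K J H m L n := by
  rw [aeval_eq_sum_range, Finset.sum_mul, Finset.sum_smul]
  refine Submodule.sum_mem _ fun j hj => ?_
  rw [smul_mul_assoc, smul_assoc]
  refine Submodule.smul_mem _ _ (Submodule.subset_span ⟨i, j, ?_, rfl⟩)
  have := Finset.mem_range.1 hj
  omega

lemma VV_H (m : M) (L n : ℕ) (x : M) (hx : x ∈ VV K J H m L n) :
    H • x ∈ VV K J H m L (n + 1) := by
  refine (Submodule.span_le (p := (VV K J H m L (n+1)).comap (ac K M H))).2 ?_ hx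
  rintro _ ⟨i, j, h, rfl⟩
  refine Submodule.subset_span ⟨i, j + 1, by omega, ?_⟩
  rw [ac_apply, ← mul_smul, pow_succ', mul_assoc]

namespace Ctx

lemma VV_J (c : Ctx K D J H) (m : M) (L n : ℕ) (x : M) (hx : x ∈ VV K J H m L n) :
    J • x ∈ VV K J H m L (n + L) := by
  refine (Submodule.span_le (p := (VV K J H m L (n+L)).comap (ac K M J))).2 ?_ hx
  rintro _ ⟨i, j, h, rfl⟩
  have e : J • (H ^ j * J ^ i) • m = (aeval H ((X ^ j : K[X]).comp (X - 1)) * J ^ (i + 1)) • m := by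
    rw [← mul_smul, ← mul_assoc, pow_succ', ← mul_assoc, ← c.JqH]; simp
  change J • (H ^ j * J ^ i) • m ∈ VV K J H m L (n + L)
  rw [e]
  refine VV_poly m L _ _ j _ ?_ (by rw [mul_add]; omega)
  refine natDegree_comp_le.trans ?_
  have : (X - 1 : K[X]).natDegree = 1 := natDegree_X_sub_C (1 : K)
  simp [this]

lemma JnqH (c : Ctx K D J H) (n : ℕ) (q : K[X]) :
    J ^ n * aeval H q = aeval H (q.comp (X - C (n : K))) * J ^ n := by
  induction n with
  | zero => simp
  | succ n ih =>
    rw [pow_succ', mul_assoc, ih, ← mul_assoc, c.JqH, comp_assoc, mul_assoc]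
    congr 3
    simp
    ring

lemma VV_red (c : Ctx K D J H) (m : M) (p : K[X][X]) (hp : p ≠ 0) (hm : Phi H J p • m = 0)
    (L : ℕ) (hL : ∀ i, (p.coeff i).natDegree < L) (n : ℕ) :
    VV K J H m L n ≤ Submodule.span K {x | ∃ i j : ℕ, j + L * i < n ∧
      (i < p.natDegree ∨ j < p.leadingCoeff.natDegree) ∧ x = (H ^ j * J ^ i) • m} := by
  induction n with
  | zero => refine Submodule.span_le.2 ?_; rintro _ ⟨i, j, h, -⟩; omega
  | succ n ih =>
    have ih' : VV K J H m L n ≤ Submodule.span K {x | ∃ i j : ℕ, j + L * i < n + 1 ∧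
      (i < p.natDegree ∨ j < p.leadingCoeff.natDegree) ∧ x = (H ^ j * J ^ i) • m} := by
      refine ih.trans (Submodule.span_mono ?_)
      rintro _ ⟨i, j, h, h2, h3⟩
      exact ⟨i, j, by omega, h2, h3⟩
    refine Submodule.span_le.2 ?_
    rintro _ ⟨i, j, h, rfl⟩
    by_cases h1 : i < p.natDegree ∨ j < p.leadingCoeff.natDegree
    · exact Submodule.subset_span ⟨i, j, h, h1, rfl⟩
    apply ih'
    rcases Nat.lt_succ_iff_lt_or_eq.1 h with h2 | h2
    · exact Submodule.subset_span ⟨i, j, h2, rfl⟩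
    push Not at h1
    obtain ⟨h3, h4⟩ := h1
    set d := p.natDegree with hd
    set e := p.leadingCoeff.natDegree with he
    set P : ℕ → K[X] := fun l => X ^ (j - e) * (p.coeff l).comp (X - C ((i - d : ℕ) : K)) with hP
    have hsum : ∑ l ∈ Finset.range (d + 1), (aeval H (P l) * J ^ (i - d + l)) • m = 0 := by
      have := congrArg (fun x => (H ^ (j - e) * J ^ (i - d)) • x) hm
      simp only [smul_zero, Phi_range, Finset.smul_sum, Finset.sum_smul] at this
      rw [← this]
      refine Finset.sum_congr rfl fun l _ => ?_
      rw [← mul_smul]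
      congr 1
      simp only [hP, map_mul, map_pow, aeval_X]
      rw [pow_add, ← mul_assoc, mul_assoc (H ^ (j-e)), ← c.JnqH]
      simp only [mul_assoc]
    have hdegc : ∀ q : K[X], (q.comp (X - C ((i - d : ℕ) : K))).natDegree = q.natDegree := by
      intro q; rw [natDegree_comp, natDegree_X_sub_C, mul_one]
    have hdeg : ∀ l, (P l).natDegree ≤ (j - e) + (p.coeff l).natDegree := by
      intro l
      refine natDegree_mul_le.trans ?_
      rw [hdegc, natDegree_X_pow]
    have hPd : (P d).natDegree ≤ j := by
      refine (hdeg d).trans ?_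
      have : (p.coeff d).natDegree = e := rfl
      omega
    have hlc : (P d).coeff j ≠ 0 := by
      have h5 : (P d).natDegree = j := by
        rw [hP]
        have h6 : (p.coeff d).comp (X - C ((i - d : ℕ) : K)) ≠ 0 := by
          intro h0
          rw [comp_eq_zero_iff] at h0
          rcases h0 with h0 | h0
          · exact hp (leadingCoeff_eq_zero.1 h0)
          · have := congrArg natDegree h0.2
            rw [natDegree_X_sub_C, natDegree_C] at this
            omega
        rw [natDegree_mul (pow_ne_zero _ X_ne_zero) h6, hdegc, natDegree_X_pow]
        have : (p.coeff d).natDegree = e := rfl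
        omega
      rw [← h5, coeff_natDegree, Ne, leadingCoeff_eq_zero]
      intro h0
      rw [hP] at h0
      simp only [mul_eq_zero, pow_eq_zero_iff', X_ne_zero, false_and, false_or] at h0
      rw [comp_eq_zero_iff] at h0
      rcases h0 with h0 | h0
      · exact hp (leadingCoeff_eq_zero.1 h0)
      · have := congrArg natDegree h0.2
        rw [natDegree_X_sub_C, natDegree_C] at this
        omega
    have hkey : (P d).coeff j • ((H ^ j * J ^ i) • m) ∈ VV K J H m L n := by
      rw [Finset.sum_range_succ, Nat.sub_add_cancel h3, aeval_eq_sum_range' (Nat.lt_succ_of_le hPd),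
        Finset.sum_range_succ, add_mul, add_smul, smul_mul_assoc, smul_assoc, ← add_assoc] at hsum
      rw [eq_neg_of_add_eq_zero_right hsum]
      refine Submodule.neg_mem _ (Submodule.add_mem _ (Submodule.sum_mem _ fun l hl => ?_) ?_)
      · have hl' := Finset.mem_range.1 hl
        refine VV_poly m L _ _ _ _ (hdeg l) ?_
        have h6 := hL l
        have h7 : L * (i - d + l) + L ≤ L * i := by
          calc _ = L * (i - d + l + 1) := by ring
            _ ≤ _ := Nat.mul_le_mul_left _ (by omega)
        omega
      · rw [Finset.sum_mul, Finset.sum_smul]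
        refine Submodule.sum_mem _ fun l hl => ?_
        have hl' := Finset.mem_range.1 hl
        rw [smul_mul_assoc, smul_assoc]
        exact Submodule.smul_mem _ _ (Submodule.subset_span ⟨i, l, by omega, rfl⟩)
    exact (Submodule.smul_mem_iff _ hlc).1 hkey

lemma VV_fin (c : Ctx K D J H) (m : M) (p : K[X][X]) (hp : p ≠ 0) (hm : Phi H J p • m = 0)
    (L : ℕ) (hL : ∀ i, (p.coeff i).natDegree < L) (n : ℕ) :
    FiniteDimensional K (VV K J H m L n) ∧
    Module.finrank K (VV K J H m L n) ≤ (p.natDegree + p.leadingCoeff.natDegree) * n := by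
  classical
  set d := p.natDegree
  set e := p.leadingCoeff.natDegree
  let S : Finset M := ((Finset.range d ×ˢ Finset.range n) ∪ (Finset.range n ×ˢ Finset.range e)).image
    fun x => (H ^ x.2 * J ^ x.1) • m
  have hle : VV K J H m L n ≤ Submodule.span K (S : Set M) := by
    refine (c.VV_red m p hp hm L hL n).trans (Submodule.span_mono ?_)
    rintro _ ⟨i, j, h, h2, rfl⟩
    have h0 := hL 0
    have : i ≤ L * i := Nat.le_mul_of_pos_left _ (by omega)
    simp only [S, Finset.coe_image, Set.mem_image]
    refine ⟨(i, j), ?_, rfl⟩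
    simp only [Finset.coe_union, Finset.coe_product, Set.mem_union, Set.mem_prod, Finset.coe_range,
      Set.mem_Iio]
    rcases h2 with h2 | h2
    · left; exact ⟨h2, by omega⟩
    · right; exact ⟨by omega, h2⟩
  have hcard : S.card ≤ (d + e) * n := by
    refine Finset.card_image_le.trans ((Finset.card_union_le _ _).trans ?_)
    simp only [Finset.card_product, Finset.card_range]
    apply le_of_eq; ring
  exact ⟨Submodule.finiteDimensional_of_le hle, (Submodule.finrank_mono hle).trans
    ((finrank_span_finset_le_card S).trans hcard)⟩

lemma lg (c : Ctx K D J H) [IsSimpleModule A M] : LG K D J H M := by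
  obtain ⟨m, hm0, ⟨p, hp, hm⟩, hE⟩ := c.exists_gen (M := M)
  obtain ⟨L, hL⟩ : ∃ L : ℕ, ∀ i, (p.coeff i).natDegree < L := by
    refine ⟨(p.support.sup fun i => (p.coeff i).natDegree) + 1, fun i => ?_⟩
    rw [Nat.lt_succ_iff]
    by_cases h : i ∈ p.support
    · exact Finset.le_sup (f := fun i => (p.coeff i).natDegree) h
    · rw [notMem_support_iff.1 h]; simp
  have hL1 : 1 ≤ L := by have := hL 0; omega
  have hmV : ∀ n, 0 < n → m ∈ VV K J H m L n := fun n hn =>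
    Submodule.subset_span ⟨0, 0, by simpa using hn, by simp⟩
  set C := p.natDegree + p.leadingCoeff.natDegree
  let G : ℕ → Submodule K M := fun n => (VV K J H m L (2 * L * n + 1)).map (ac K M (D ^ n))
  have hup : ∀ n x, x ∈ VV K J H m L (2 * L * n + 1 + L) → D ^ n • x ∈ G (n + 1) := by
    intro n x hx
    refine ⟨J • x, VV_mono m L ?_ (c.VV_J m L _ x hx), ?_⟩
    · apply le_of_eq; ring
    · rw [ac_apply, pow_succ, mul_smul, ← mul_smul D J, c.hDJ, one_smul]
  have hmono : Monotone G := by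
    refine monotone_nat_of_le_succ fun n => ?_
    rintro _ ⟨x, hx, rfl⟩
    exact hup n x (VV_mono m L (by omega) hx)
  have hmG : ∀ n, m ∈ G n := fun n => hmono (Nat.zero_le n) ⟨m, hmV _ (by simp), by simp [ac_apply]⟩
  have hfin : ∀ n, FiniteDimensional K (VV K J H m L n) := fun n => (c.VV_fin m p hp hm L hL n).1
  have hst : ∀ n, ∀ x ∈ G n, D • x ∈ G (n + 1) ∧ J • x ∈ G (n + 1) ∧ H • x ∈ G (n + 1) := by
    rintro n _ ⟨x, hx, rfl⟩
    refine ⟨⟨x, VV_mono m L ?_ hx, ?_⟩, ?_, ?_⟩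
    · have : 2 * L * n ≤ 2 * L * (n + 1) := Nat.mul_le_mul_left _ (by omega)
      omega
    · rw [ac_apply, ac_apply, pow_succ', mul_smul]
    · cases n with
      | zero =>
        have := hup 0 (J • x) (c.VV_J m L _ x hx)
        simpa [ac_apply] using this
      | succ n =>
        have e : J • (D ^ (n+1) • x) = D ^ n • x - (1 - J * D) • D ^ n • x := by
          rw [pow_succ', sub_smul, mul_smul, mul_smul]; simp
        obtain ⟨k, hk⟩ := hE (D ^ n • x)
        rw [ac_apply, e, hk]
        refine Submodule.sub_mem _ ?_ (Submodule.smul_mem _ _ (hmG _))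
        refine ⟨J ^ 2 • x, ?_, ?_⟩
        · rw [pow_two, mul_smul]
          refine VV_mono m L ?_ (c.VV_J m L _ _ (c.VV_J m L _ x hx))
          apply le_of_eq; ring
        · rw [ac_apply, add_assoc, pow_add, mul_smul, ← mul_smul (D ^ (1+1)), c.DJn, one_smul]
    · rw [ac_apply, ← mul_smul, c.HDn, mul_smul]
      apply hup
      rw [sub_smul]
      refine Submodule.sub_mem _ (VV_mono m L (by omega) (VV_H m L _ x hx)) ?_
      rw [Nat.cast_smul_eq_nsmul]
      exact Submodule.smul_of_tower_mem _ _ (VV_mono m L (by omega) hx)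
  refine ⟨G, C * (2 * L + 1), hmono, fun n => ?_, fun n => ?_, ?_, hst⟩
  · infer_instance
  · refine (Submodule.finrank_map_le _ _).trans ((c.VV_fin m p hp hm L hL _).2.trans ?_)
    rw [mul_assoc C]
    refine Nat.mul_le_mul_left _ ?_
    nlinarith
  · have hdir : Directed (· ≤ ·) G := hmono.directed_le
    have hmem : ∀ x, x ∈ (⨆ n, G n) ↔ ∃ n, x ∈ G n := fun x => Submodule.mem_iSup_of_directed G hdir
    intro x
    obtain ⟨b, rfl⟩ := IsSimpleModule.toSpanSingleton_surjective A hm0 x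
    rw [← hmem]
    refine c.stable (⨆ n, G n) ?_ ?_ ?_ b m ((hmem m).2 ⟨0, hmG 0⟩)
    · intro y hy; obtain ⟨n, hn⟩ := (hmem y).1 hy; exact (hmem _).2 ⟨_, (hst n y hn).1⟩
    · intro y hy; obtain ⟨n, hn⟩ := (hmem y).1 hy; exact (hmem _).2 ⟨_, (hst n y hn).2.1⟩
    · intro y hy; obtain ⟨n, hn⟩ := (hmem y).1 hy; exact (hmem _).2 ⟨_, (hst n y hn).2.2⟩

end Ctx

lemma fd_of_card_le {V : Type*} [AddCommGroup V] [Module K V] (n : ℕ)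
    (h : ∀ s : Finset V, LinearIndependent K (fun i : s => (i : V)) → s.card ≤ n) :
    FiniteDimensional K V := by
  have := rank_le h
  exact Module.rank_lt_aleph0_iff.1 (this.trans_lt (Cardinal.natCast_lt_aleph0))

lemma exists_const_rel {ι : Type*} (Rel : Submodule K[X] (ι →₀ K[X])) (T : K[X] → K[X])
    (hT0 : T 0 = 0)
    (hT : ∀ r s : K[X], r ≠ 0 → r * T s = T r * s → ∃ c : K, s = C c * r)
    (hst : ∀ l ∈ Rel, l.mapRange T hT0 ∈ Rel) (l₀ : ι →₀ K[X]) (h₀ : l₀ ∈ Rel) (hl₀ : l₀ ≠ 0) :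
    ∃ l ∈ Rel, l ≠ 0 ∧ ∃ r : K[X], r ≠ 0 ∧ ∀ k, ∃ c : K, l k = C c * r := by
  classical
  obtain ⟨l, ⟨hl, hl0⟩, hmin⟩ := exists_minimal_of_wellFoundedLT
    (fun n : ℕ => ∃ l ∈ Rel, l ≠ 0 ∧ l.support.card = n) ⟨_, l₀, h₀, hl₀, rfl⟩ |>.imp
    (fun n hn => hn) |> fun ⟨n, hn⟩ => (by
      obtain ⟨⟨l, hl, hl0, hc⟩, hm⟩ := hn
      refine ⟨l, ⟨hl, hl0⟩, fun l' (h1 : l' ∈ Rel) (h2 : l' ≠ 0) => ?_⟩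
      have := not_lt.1 fun hlt => absurd (hm ⟨l', h1, h2, rfl⟩ hlt.le) (not_le.2 hlt)
      rw [← hc] at this
      exact this : ∃ l : ι →₀ K[X], (l ∈ Rel ∧ l ≠ 0) ∧
        ∀ l' : ι →₀ K[X], l' ∈ Rel → l' ≠ 0 → l.support.card ≤ l'.support.card)
  obtain ⟨k0, hk0⟩ := Finsupp.ne_iff.1 hl0
  rw [Finsupp.zero_apply] at hk0
  refine ⟨l, hl, hl0, l k0, hk0, fun k => hT _ _ hk0 ?_⟩
  set l' : ι →₀ K[X] := l k0 • l.mapRange T hT0 - T (l k0) • l with hl'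
  have hR : l' ∈ Rel := Rel.sub_mem (Rel.smul_mem _ (hst l hl)) (Rel.smul_mem _ hl)
  have hz : l' = 0 := by
    by_contra hne
    have := hmin l' hR hne
    have hss : l'.support ⊂ l.support := by
      refine Finset.ssubset_iff_subset_ne.2 ⟨?_, ?_⟩
      · intro x hx
        rw [Finsupp.mem_support_iff] at hx ⊢
        intro h0
        apply hx
        simp [hl', h0, hT0]
      · intro h
        have : k0 ∈ l'.support := by rw [h, Finsupp.mem_support_iff]; exact hk0
        rw [Finsupp.mem_support_iff] at this
        apply this
        simp [hl', mul_comm]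
    exact absurd (Finset.card_lt_card hss) (not_lt.2 this)
  have := DFunLike.congr_fun hz k
  simpa [hl', sub_eq_zero] using this

lemma indep_lift {N : Type*} [AddCommGroup N] [Module K N] [Module K[X] N] [IsScalarTower K K[X] N]
    (htf : ∀ (q : K[X]) (x : N), q ≠ 0 → q • x = 0 → x = 0)
    (u : ℕ → N → N) (hu0 : ∀ x, u 0 x = x) (d : ℕ) (P : ℕ → K[X]) (hP : P d ≠ 0)
    (T : K[X] → K[X]) (hT0 : T 0 = 0)
    (hT : ∀ r s : K[X], r ≠ 0 → r * T s = T r * s → ∃ c : K, s = C c * r)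
    {ι : Type*} (v : ι → N) (hv : LinearIndependent K v)
    (hker : ∀ k, ∑ i ∈ Finset.range (d + 1), P i • u i (v k) = 0)
    (hstep : ∀ l : ι →₀ K[X], (∀ i ≤ d, (l.sum fun k r => r • u i (v k)) = 0) →
      ∀ i < d, (l.sum fun k r => T r • u i (v k)) = 0) :
    LinearIndependent K[X] (fun k => fun i : Fin d => u i (v k)) := by
  classical
  have hcomb : ∀ l : ι →₀ K[X], ∀ i : Fin d,
      (Finsupp.linearCombination K[X] (fun k => fun i : Fin d => u i (v k)) l) i
        = l.sum fun k r => r • u i (v k) := by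
    intro l i
    rw [Finsupp.linearCombination_apply, Finsupp.sum, Finsupp.sum, Finset.sum_apply]
    rfl
  have htop : ∀ l : ι →₀ K[X], (∀ i < d, (l.sum fun k r => r • u i (v k)) = 0) →
      ∀ i ≤ d, (l.sum fun k r => r • u i (v k)) = 0 := by
    intro l h i hi
    rcases hi.lt_or_eq with hi | rfl
    · exact h i hi
    apply htf (P i) _ hP
    have h1 : ∑ j ∈ Finset.range (i + 1), P j • (l.sum fun k r => r • u j (v k)) = 0 := by
      simp only [Finsupp.sum, Finset.smul_sum]
      rw [Finset.sum_comm]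
      refine Finset.sum_eq_zero fun k _ => ?_
      have := congrArg (fun x => l k • x) (hker k)
      simp only [smul_zero, Finset.smul_sum] at this
      rw [← this]
      refine Finset.sum_congr rfl fun j _ => smul_comm _ _ _
    rw [Finset.sum_range_succ, Finset.sum_eq_zero, zero_add] at h1
    · exact h1
    · intro j hj
      rw [h j (Finset.mem_range.1 hj), smul_zero]
  rw [linearIndependent_iff]
  intro l₀ hl₀
  by_contra hne
  obtain ⟨l, hl, hl0, r, hr, hc⟩ := exists_const_rel
    (LinearMap.ker (Finsupp.linearCombination K[X] (fun k => fun i : Fin d => u i (v k)))) T hT0 hT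
    (by
      intro l hl
      rw [LinearMap.mem_ker] at hl ⊢
      have h1 : ∀ i < d, (l.sum fun k r => r • u i (v k)) = 0 := by
        intro i hi
        rw [← hcomb l ⟨i, hi⟩, hl]; rfl
      funext i
      rw [hcomb, Finsupp.sum_mapRange_index (by simp)]
      exact hstep l (htop l h1) i i.2) l₀ hl₀ hne
  choose c hc using hc
  rw [LinearMap.mem_ker] at hl
  have h1 : ∀ i < d, (l.sum fun k r => r • u i (v k)) = 0 := by
    intro i hi
    rw [← hcomb l ⟨i, hi⟩, hl]; rfl
  have h2 := htop l h1 0 (Nat.zero_le d)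
  simp only [hu0] at h2
  have h3 : r • ∑ k ∈ l.support, c k • v k = 0 := by
    rw [← h2, Finsupp.sum, Finset.smul_sum]
    refine Finset.sum_congr rfl fun k _ => ?_
    rw [hc k, mul_comm, mul_smul, ← algebraMap_eq, algebraMap_smul]
  have h4 := htf r _ hr h3
  have h5 := linearIndependent_iff'.1 hv l.support c h4
  apply hl0
  ext1 k
  by_cases hk : k ∈ l.support
  · rw [hc k, h5 k hk]; simp
  · simpa using hk

lemma count {N : Type*} [AddCommGroup N] [Module K N] [Module K[X] N] [IsScalarTower K K[X] N]
    (G : ℕ → Submodule K N) (c : ℕ) (hmono : Monotone G) (hfd : ∀ n, FiniteDimensional K (G n))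
    (hdim : ∀ n, Module.finrank K (G n) ≤ c * (n + 1)) (hex : ∀ x, ∃ n, x ∈ G n)
    (hX : ∀ n, ∀ x ∈ G n, (X : K[X]) • x ∈ G (n + 1))
    {ι : Type*} [Fintype ι] (d : ℕ) (w : ι → (Fin d → N)) (hw : LinearIndependent K[X] w) :
    Fintype.card ι ≤ d * c := by
  classical
  choose e he using hex
  let n0 := Finset.univ.sup fun x : ι × Fin d => e (w x.1 x.2)
  have hn0 : ∀ k i, w k i ∈ G n0 := fun k i =>
    hmono (Finset.le_sup (f := fun x : ι × Fin d => e (w x.1 x.2)) (Finset.mem_univ (k, i)))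
      (he _)
  have hXn : ∀ n a x, x ∈ G a → (X ^ n : K[X]) • x ∈ G (a + n) := by
    intro n
    induction n with
    | zero => intro a x hx; simpa using hx
    | succ n ih =>
      intro a x hx
      rw [pow_succ', mul_smul]
      exact hX _ _ (ih a x hx)
  have hli := linearIndependent_smul (Polynomial.basisMonomials K).linearIndependent hw
  have main : ∀ n : ℕ, n * Fintype.card ι ≤ d * (c * (n0 + n + 1)) := by
    intro n
    let z : Fin n × ι → (Fin d → G (n0 + n)) := fun x i =>
      ⟨(X ^ (x.1 : ℕ) : K[X]) • w x.2 i, hmono (by omega) (hXn _ _ _ (hn0 x.2 i))⟩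
    let f : (Fin d → G (n0 + n)) →ₗ[K] (Fin d → N) :=
      LinearMap.pi fun i => (G (n0 + n)).subtype ∘ₗ LinearMap.proj i
    have hz : LinearIndependent K z := by
      apply LinearIndependent.of_comp f
      have := hli.comp (fun x : Fin n × ι => ((x.1 : ℕ), x.2)) (by
        rintro ⟨a, b⟩ ⟨a', b'⟩ h
        simp only [Prod.mk.injEq] at h
        exact Prod.ext (Fin.ext h.1) h.2)
      convert this using 1
      funext x
      funext i
      simp only [Function.comp, f, z, LinearMap.pi_apply, coe_basisMonomials, Pi.smul_apply]
      simp [← X_pow_eq_monomial]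
    have h1 := hz.fintype_card_le_finrank
    rw [Fintype.card_prod, Fintype.card_fin, Module.finrank_pi_fintype] at h1
    simp only [Finset.sum_const, Finset.card_univ, Fintype.card_fin, smul_eq_mul] at h1
    exact h1.trans (Nat.mul_le_mul_left _ (hdim _))
  by_contra hlt
  push Not at hlt
  have h1 := main (d * c * (n0 + 1) + 1)
  have h2 : (d * c * (n0 + 1) + 1) * (d * c + 1) ≤ (d * c * (n0 + 1) + 1) * Fintype.card ι :=
    Nat.mul_le_mul_left _ hlt
  nlinarith

lemma const_der (r s : K[X]) (hr : r ≠ 0)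
    (h : r * (X * derivative s) = (X * derivative r) * s) : ∃ c : K, s = C c * r := by
  set c := s.coeff r.natDegree / r.leadingCoeff
  refine ⟨c, ?_⟩
  by_contra hne
  set t := s - C c * r with ht
  have ht0 : t ≠ 0 := sub_ne_zero.2 hne
  have hlr : r.leadingCoeff ≠ 0 := leadingCoeff_ne_zero.2 hr
  have hco : t.coeff r.natDegree = 0 := by
    rw [ht, coeff_sub, coeff_C_mul, coeff_natDegree, div_mul_cancel₀ _ hlr, sub_self]
  have h2 : r * (X * derivative t) = (X * derivative r) * t := by
    rw [ht]; simp only [derivative_sub, derivative_C_mul]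
    linear_combination h
  have hd : ∀ q : K[X], (X * derivative q).natDegree ≤ q.natDegree := by
    intro q
    by_cases hq : q.natDegree = 0
    · rw [derivative_of_natDegree_zero hq]; simp
    · have := natDegree_derivative_lt hq
      refine natDegree_mul_le.trans ?_
      rw [natDegree_X]; omega
  have hcf : ∀ (q : K[X]) n, (X * derivative q).coeff n = n * q.coeff n := by
    intro q n
    cases n with
    | zero => simp
    | succ n => rw [coeff_X_mul, coeff_derivative]; push_cast; ring
  have h3 := congrArg (fun q => q.coeff (r.natDegree + t.natDegree)) h2
  rw [coeff_mul_add_eq_of_natDegree_le le_rfl (hd t), coeff_mul_add_eq_of_natDegree_le (hd r) le_rfl, hcf, hcf,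
    coeff_natDegree, coeff_natDegree] at h3
  have hlt : t.leadingCoeff ≠ 0 := leadingCoeff_ne_zero.2 ht0
  have h4 : (t.natDegree : K) = r.natDegree := by
    apply mul_right_cancel₀ (mul_ne_zero hlr hlt)
    linear_combination h3
  have h5 : t.natDegree = r.natDegree := by exact_mod_cast h4
  rw [← h5, coeff_natDegree] at hco
  exact hlt hco

lemma const_shift (r s : K[X]) (hr : r ≠ 0)
    (h : r * s.comp (X + 1) = r.comp (X + 1) * s) : ∃ c : K, s = C c * r := by
  have hfin : {n : ℕ | r.eval (n : K) = 0}.Finite := by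
    have : {n : ℕ | r.eval (n : K) = 0} = (fun n : ℕ => (n : K)) ⁻¹' {x | r.IsRoot x} := rfl
    rw [this]
    exact (Polynomial.finite_setOfPred_isRoot hr).preimage (Nat.cast_injective.injOn)
  obtain ⟨b, hb⟩ := hfin.bddAbove
  have hne : ∀ n : ℕ, b < n → r.eval (n : K) ≠ 0 := fun n hn h0 => absurd (hb h0) (not_le.2 hn)
  set c := s.eval ((b + 1 : ℕ) : K) / r.eval ((b + 1 : ℕ) : K)
  have hall : ∀ k : ℕ, s.eval ((b + 1 + k : ℕ) : K) = c * r.eval ((b + 1 + k : ℕ) : K) := by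
    intro k
    induction k with
    | zero => simp only [add_zero, c]; rw [div_mul_cancel₀ _ (hne _ (by omega))]
    | succ k ih =>
      have h1 := congrArg (fun q => q.eval ((b + 1 + k : ℕ) : K)) h
      simp only [eval_mul, eval_comp, eval_add, eval_X, eval_one] at h1
      rw [ih] at h1
      have h2 : ((b + 1 + (k + 1) : ℕ) : K) = ((b + 1 + k : ℕ) : K) + 1 := by push_cast; ring
      rw [h2]
      apply mul_left_cancel₀ (hne (b + 1 + k) (by omega))
      linear_combination h1
  refine ⟨c, ?_⟩
  apply Polynomial.eq_of_infinite_eval_eq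
  refine Set.infinite_of_injective_forall_mem (f := fun k : ℕ => ((b + 1 + k : ℕ) : K)) ?_ ?_
  · intro x y hxy
    have : b + 1 + x = b + 1 + y := Nat.cast_injective hxy
    omega
  · intro k
    simpa using hall k

/-- kernel bound, generic -/
lemma ker_fd_gen {N : Type*} [AddCommGroup N] [Module K N] [Module A N] [IsScalarTower K A N]
    (B Z : A) (htf : ∀ (q : K[X]) (x : N), q ≠ 0 → aeval B q • x = 0 → x = 0)
    (G : ℕ → Submodule K N) (c : ℕ) (hmono : Monotone G) (hfd : ∀ n, FiniteDimensional K (G n))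
    (hdim : ∀ n, Module.finrank K (G n) ≤ c * (n + 1)) (hex : ∀ x, ∃ n, x ∈ G n)
    (hX : ∀ n, ∀ x ∈ G n, B • x ∈ G (n + 1))
    (p : K[X][X]) (hp : p ≠ 0)
    (T : K[X] → K[X]) (hT0 : T 0 = 0)
    (hT : ∀ r s : K[X], r ≠ 0 → r * T s = T r * s → ∃ c : K, s = C c * r)
    (hstep : ∀ (S : Finset N) (l : N → K[X]) (d : ℕ),
      (∀ i ≤ d, ∑ x ∈ S, aeval B (l x) • Z ^ i • x = 0) →
      ∀ i < d, ∑ x ∈ S, aeval B (T (l x)) • Z ^ i • x = 0) :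
    FiniteDimensional K (LinearMap.ker (ac K N (Phi B Z p))) := by
  classical
  letI : Module K[X] N := Module.compHom N (aeval B : K[X] →ₐ[K] A).toRingHom
  have hact : ∀ (q : K[X]) (x : N), q • x = aeval B q • x := fun _ _ => rfl
  haveI : IsScalarTower K K[X] N := ⟨fun a q x => by rw [hact, hact, map_smul, smul_assoc]⟩
  refine fd_of_card_le (p.natDegree * c) fun s hs => ?_
  rw [← Fintype.card_coe]
  let v : s → N := fun i => ((i : LinearMap.ker (ac K N (Phi B Z p))) : N)
  have hv : LinearIndependent K v := hs.map' (Submodule.subtype _) (Submodule.ker_subtype _)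
  have hvi : Function.Injective v := hv.injective
  refine count G c hmono hfd hdim hex (fun n x hx => by rw [hact, aeval_X]; exact hX n x hx)
    p.natDegree _ (indep_lift (fun q x hq hx => htf q x hq hx) (fun i x => Z ^ i • x) (by simp)
      p.natDegree p.coeff (by simpa using hp) T hT0 hT v hv ?_ ?_)
  · intro k
    have h : Phi B Z p • v k = 0 := (k : LinearMap.ker (ac K N (Phi B Z p))).2
    have e := congrArg (fun a => a • v k) (Phi_range B Z p)
    simp only [Finset.sum_smul] at e
    simp only [hact, ← mul_smul]
    exact e.symm.trans h
  · intro l hl i hi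
    let S : Finset N := l.support.map ⟨v, hvi⟩
    let l' : N → K[X] := Function.extend v l 0
    have hl' : ∀ k, l' (v k) = l k := fun k => hvi.extend_apply _ _ _
    have := hstep S l' p.natDegree (by
      intro i hi
      have := hl i hi
      simp only [S, Finset.sum_map, Function.Embedding.coeFn_mk, hl']
      exact this) i hi
    simp only [S, Finset.sum_map, Function.Embedding.coeFn_mk, hl'] at this
    exact this

namespace Ctx

lemma simple_stable (c : Ctx K D J H) [IsSimpleModule A M] (N : Submodule K M)
    (hD : ∀ m ∈ N, D • m ∈ N) (hJ : ∀ m ∈ N, J • m ∈ N) (hH : ∀ m ∈ N, H • m ∈ N)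
    (x : M) (hx : x ∈ N) (hx0 : x ≠ 0) (y : M) : y ∈ N := by
  obtain ⟨b, rfl⟩ := IsSimpleModule.toSpanSingleton_surjective A hx0 y
  exact c.stable N hD hJ hH b x hx

lemma pow_mem_span (B : A) (x : M) (q : K[X]) (hq : q ≠ 0) (h : aeval B q • x = 0) (j : ℕ) :
    B ^ j • x ∈ Submodule.span K {y | ∃ i ≤ q.natDegree, y = B ^ i • x} := by
  have h1 : B ^ j • x = aeval B (X ^ j % q) • x := by
    conv_lhs => rw [show B ^ j = aeval B (X ^ j : K[X]) by simp, ← EuclideanDomain.mod_add_div (X ^ j) q]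
    rw [mul_comm, map_add, map_mul, add_smul, mul_smul, h, smul_zero, add_zero]
  rw [h1, aeval_eq_sum_range' (n := q.natDegree + 1)
    (Nat.lt_succ_of_le (natDegree_le_natDegree (degree_mod_lt _ hq).le)), Finset.sum_smul]
  refine Submodule.sum_mem _ fun i hi => ?_
  rw [smul_assoc]
  exact Submodule.smul_mem _ _ (Submodule.subset_span
    ⟨i, Nat.lt_succ_iff.1 (Finset.mem_range.1 hi), rfl⟩)

lemma not_both (c : Ctx K D J H) (m : M) (q s : K[X]) (hq : q ≠ 0) (hs : s ≠ 0)
    (h1 : aeval J q • m = 0) (h2 : aeval H s • m = 0) : m = 0 := by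
  let N : Submodule K M := Submodule.span K {y | ∃ i j : ℕ, y = H ^ j • J ^ i • m}
  have hN : ∀ i j, H ^ j • J ^ i • m ∈ N := fun i j => Submodule.subset_span ⟨i, j, rfl⟩
  have hpoly : ∀ (r : K[X]) i, aeval H r • J ^ i • m ∈ N := by
    intro r i
    rw [aeval_eq_sum_range, Finset.sum_smul]
    refine Submodule.sum_mem _ fun j _ => ?_
    rw [smul_assoc]
    exact Submodule.smul_mem _ _ (hN i j)
  let S : Set M := (fun x : ℕ × ℕ => H ^ x.2 • J ^ x.1 • m) ''
    (Set.Iic q.natDegree ×ˢ Set.Iic s.natDegree)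
  have hS : S.Finite := ((Set.finite_Iic _).prod (Set.finite_Iic _)).image _
  have hle : N ≤ Submodule.span K S := by
    refine Submodule.span_le.2 ?_
    rintro _ ⟨i, j, rfl⟩
    have h3 := pow_mem_span J m q hq h1 i
    refine (Submodule.span_le (p := (Submodule.span K S).comap (ac K M (H ^ j)))).2 ?_ h3
    rintro _ ⟨i, hi, rfl⟩
    have hd : (s.comp (X - C (i : K))).natDegree = s.natDegree := by
      rw [natDegree_comp, natDegree_X_sub_C, mul_one]
    have h4 := pow_mem_span H (J ^ i • m) (s.comp (X - C (i : K))) (by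
      intro h0
      rw [comp_eq_zero_iff] at h0
      rcases h0 with h0 | h0
      · exact hs h0
      · have := congrArg natDegree h0.2
        rw [natDegree_X_sub_C, natDegree_C] at this
        omega) (by rw [← mul_smul, ← c.JnqH, mul_smul, h2, smul_zero]) j
    rw [hd] at h4
    refine Submodule.span_mono ?_ h4
    rintro _ ⟨j, hj, rfl⟩
    exact ⟨(i, j), ⟨hi, hj⟩, rfl⟩
  haveI : FiniteDimensional K (Submodule.span K S) := FiniteDimensional.span_of_finite K hS
  haveI : FiniteDimensional K N := Submodule.finiteDimensional_of_le hle
  have hbot := c.inf N (by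
    intro x hx
    refine (Submodule.span_le (p := N.comap (ac K M J))).2 ?_ hx
    rintro _ ⟨i, j, rfl⟩
    change J • H ^ j • J ^ i • m ∈ N
    have e : J • (H ^ j • J ^ i • m) = aeval H ((X ^ j : K[X]).comp (X - 1)) • J ^ (i + 1) • m := by
      rw [pow_succ', mul_smul J, ← mul_smul _ J, ← c.JqH, mul_smul]; simp
    rw [e]
    exact hpoly _ _) (by
    intro x hx
    refine (Submodule.span_le (p := N.comap (ac K M H))).2 ?_ hx
    rintro _ ⟨i, j, rfl⟩
    change H • H ^ j • J ^ i • m ∈ N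
    rw [← mul_smul, ← pow_succ']
    exact hN _ _)
  have := hN 0 0
  rw [hbot] at this
  simpa using this

lemma J_tors (c : Ctx K D J H) [IsSimpleModule A M] (q : K[X]) (hq : q ≠ 0) (x : M) (hx : x ≠ 0)
    (h : aeval J q • x = 0) (y : M) : ∃ q : K[X], q ≠ 0 ∧ aeval J q • y = 0 := by
  let N : Submodule K M :=
    { carrier := {v | ∃ q : K[X], q.coeff 0 ≠ 0 ∧ aeval J q • v = 0}
      zero_mem' := ⟨1, by simp⟩
      add_mem' := by
        rintro a b ⟨q, hq, ha⟩ ⟨r, hr, hb⟩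
        refine ⟨q * r, by simp [mul_coeff_zero, hq, hr], ?_⟩
        rw [smul_add, map_mul, mul_smul _ _ b, hb, ← map_mul, mul_comm, map_mul, mul_smul, ha]
        simp
      smul_mem' := by
        rintro k a ⟨q, hq, ha⟩
        exact ⟨q, hq, by rw [smul_comm, ha, smul_zero]⟩ }
  have hxN : x ∈ N := by
    obtain ⟨r, hr, hr2⟩ := Polynomial.exists_eq_pow_rootMultiplicity_mul_and_not_dvd q hq 0
    refine ⟨r, ?_, ?_⟩
    · rw [Ne, ← X_dvd_iff]; simpa using hr2
    · rw [hr] at h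
      generalize rootMultiplicity 0 q = n at h
      simp only [map_zero, sub_zero, map_mul, map_pow, aeval_X, mul_smul] at h
      have := congrArg (fun x => D ^ n • x) h
      simpa [← mul_smul _ (J ^ n), c.DJn] using this
  obtain ⟨r, hr, hy⟩ : y ∈ N := by
    refine c.simple_stable N ?_ ?_ ?_ x hxN hx y
    · rintro m ⟨q, hq, hm⟩
      refine ⟨q, hq, ?_⟩
      -- m = J u
      have h1 : q = C (q.coeff 0) + X * q.divX := by
        conv_lhs => rw [← X_mul_divX_add q, add_comm]
      have h2 : m = J • (-(q.coeff 0)⁻¹) • aeval J q.divX • m := by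
        rw [h1] at hm
        simp only [map_add, map_mul, aeval_C, aeval_X, add_smul, mul_smul, algebraMap_smul] at hm
        rw [smul_comm J, eq_neg_of_add_eq_zero_right hm, smul_neg, neg_smul, neg_neg, smul_smul,
          inv_mul_cancel₀ hq, one_smul]
      rw [h2, ← mul_smul D J, c.hDJ, one_smul, smul_comm, ← mul_smul, ← map_mul, mul_comm, map_mul,
        mul_smul, hm]
      simp
    · rintro m ⟨q, hq, hm⟩
      refine ⟨q, hq, ?_⟩
      have : aeval J q * J = J * aeval J q := by
        have : aeval J (q * X) = aeval J (X * q) := by rw [mul_comm]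
        simpa using this
      rw [← mul_smul, this, mul_smul, hm, smul_zero]
    · rintro m ⟨q, hq, hm⟩
      refine ⟨q * q, by simp [mul_coeff_zero, hq], ?_⟩
      have h1 := c.HqJ (q * q)
      have h2 : X * derivative (q * q) = (2 * X * derivative q) * q := by
        rw [derivative_mul]; ring
      rw [h2] at h1
      have h3 : aeval J (q * q) * H = H * aeval J q * aeval J q
          - aeval J (2 * X * derivative q) * aeval J q := by
        rw [← map_mul, mul_assoc, ← map_mul, h1]; simp
      rw [← mul_smul, h3, sub_smul, mul_smul _ (aeval J q) m, mul_smul _ (aeval J q) m, hm,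
        smul_zero, smul_zero, sub_zero]
  exact ⟨r, fun h0 => hr (by simp [h0]), hy⟩

lemma H_tors (c : Ctx K D J H) [IsSimpleModule A M] (q : K[X]) (hq : q ≠ 0) (x : M) (hx : x ≠ 0)
    (h : aeval H q • x = 0) (y : M) : ∃ q : K[X], q ≠ 0 ∧ aeval H q • y = 0 := by
  let N : Submodule K M :=
    { carrier := {v | ∃ q : K[X], q ≠ 0 ∧ aeval H q • v = 0}
      zero_mem' := ⟨1, by simp⟩
      add_mem' := by
        rintro a b ⟨q, hq, ha⟩ ⟨r, hr, hb⟩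
        refine ⟨q * r, mul_ne_zero hq hr, ?_⟩
        rw [smul_add, map_mul, mul_smul _ _ b, hb, ← map_mul, mul_comm, map_mul, mul_smul, ha]
        simp
      smul_mem' := by
        rintro k a ⟨q, hq, ha⟩
        exact ⟨q, hq, by rw [smul_comm, ha, smul_zero]⟩ }
  have hcomp : ∀ (q : K[X]) (a : K), q ≠ 0 → q.comp (X - C a) ≠ 0 := by
    intro q a hq h0
    rw [comp_eq_zero_iff] at h0
    rcases h0 with h0 | h0
    · exact hq h0
    · have := congrArg natDegree h0.2
      rw [natDegree_X_sub_C, natDegree_C] at this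
      omega
  refine c.simple_stable N ?_ ?_ ?_ x ⟨q, hq, h⟩ hx y
  · rintro m ⟨q, hq, hm⟩
    refine ⟨q.comp (X + 1), by simpa using hcomp q (-1) hq, ?_⟩
    rw [← mul_smul, ← c.DqH, mul_smul, hm, smul_zero]
  · rintro m ⟨q, hq, hm⟩
    refine ⟨q.comp (X - 1), by simpa using hcomp q 1 hq, ?_⟩
    rw [← mul_smul, ← c.JqH, mul_smul, hm, smul_zero]
  · rintro m ⟨q, hq, hm⟩
    refine ⟨q, hq, ?_⟩
    have : aeval H q * H = H * aeval H q := by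
      have : aeval H (q * X) = aeval H (X * q) := by rw [mul_comm]
      simpa using this
    rw [← mul_smul, this, mul_smul, hm, smul_zero]

lemma dichotomy (c : Ctx K D J H) [IsSimpleModule A M] :
    (∀ (q : K[X]) (x : M), q ≠ 0 → aeval J q • x = 0 → x = 0) ∨
    (∀ (q : K[X]) (x : M), q ≠ 0 → aeval H q • x = 0 → x = 0) := by
  by_contra hcon
  push Not at hcon
  obtain ⟨⟨q, x, hq, hqx, hx⟩, ⟨s, y, hs, hsy, hy⟩⟩ := hcon
  obtain ⟨r, hr, h⟩ := c.J_tors q hq x hx hqx y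
  exact hy (c.not_both y r s hr hs h hsy)

lemma ker_w (c : Ctx K D J H) [IsSimpleModule A M] (w : A) (hw : w ∈ Algebra.adjoin K {J, H})
    (hw0 : w ≠ 0) : FiniteDimensional K (LinearMap.ker (ac K M w)) := by
  obtain ⟨G, C, hmono, hfd, hdim, hex, hst⟩ := c.lg (M := M)
  rcases c.dichotomy (M := M) with htf | htf
  · obtain ⟨p, rfl⟩ := c.form1 w hw
    refine ker_fd_gen J H htf G C hmono hfd hdim hex (fun n x hx => (hst n x hx).2.1) p
      (by rintro rfl; exact hw0 (Phi_zero _ _)) (fun q => X * derivative q) (by simp)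
      const_der ?_
    intro S l d h i hi
    have h1 := congrArg (fun x => H • x) (h i hi.le)
    simp only [smul_zero, Finset.smul_sum, ← mul_smul] at h1
    have h2 := h (i + 1) hi
    rw [← sub_eq_zero.2 (h1.trans h2.symm), ← Finset.sum_sub_distrib]
    refine Finset.sum_congr rfl fun x _ => ?_
    rw [← mul_assoc, c.HqJ, pow_succ', add_mul, add_smul, mul_assoc, mul_smul, mul_smul _ _ x]
    simp [mul_smul]
  · obtain ⟨p, rfl⟩ := c.form2 w hw
    refine ker_fd_gen H J htf G C hmono hfd hdim hex (fun n x hx => (hst n x hx).2.2) p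
      (by rintro rfl; exact hw0 (Phi_zero _ _)) (fun q => q.comp (X + 1)) (by simp)
      const_shift ?_
    intro S l d h i hi
    have h1 := congrArg (fun x => D • x) (h (i + 1) hi)
    simp only [smul_zero, Finset.smul_sum] at h1
    rw [← h1]
    refine Finset.sum_congr rfl fun x _ => ?_
    rw [← mul_smul D, c.DqH, mul_smul, ← mul_smul D, pow_succ', ← mul_assoc, c.hDJ, one_mul]

lemma ker_simple (c : Ctx K D J H) [IsSimpleModule A M] (a : A) (ha : a ∉ FF K D J) :
    FiniteDimensional K (LinearMap.ker (ac K M a)) := by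
  obtain ⟨n, w, hw, hf, hw0⟩ := c.normal' a
  haveI := c.ker_w (M := M) w hw (hw0 ha)
  haveI := c.FF_range (M := M) _ hf
  -- restrict w to ker a: range inside range f
  let g : LinearMap.ker (ac K M a) →ₗ[K] M := (ac K M w).domRestrict _
  have hr : LinearMap.range g ≤ LinearMap.range (ac K M (J ^ n * a - w)) := by
    rintro _ ⟨x, rfl⟩
    refine ⟨-x, ?_⟩
    have hx : a • (x : M) = 0 := x.2
    change (J ^ n * a - w) • (-(x : M)) = w • (x : M)
    rw [smul_neg, sub_smul, mul_smul, hx]; simp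
  haveI : FiniteDimensional K (LinearMap.range g) := Submodule.finiteDimensional_of_le hr
  haveI : FiniteDimensional K (LinearMap.ker g) := by
    let f : LinearMap.ker g →ₗ[K] LinearMap.ker (ac K M w) :=
      ((Submodule.subtype _).comp (Submodule.subtype _)).codRestrict _ (fun x => x.2)
    refine FiniteDimensional.of_injective f ?_
    intro x y hxy
    have h : (f x).1 = (f y).1 := congrArg Subtype.val hxy
    exact Subtype.ext (Subtype.ext h)
  haveI : FiniteDimensional K (LinearMap.ker (ac K M a) ⧸ LinearMap.ker g) :=
    Module.Finite.equiv g.quotKerEquivRange.symm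
  exact Module.Finite.of_submodule_quotient (LinearMap.ker g)

end Ctx

/-- a filtered map with finite kernel on a filtration of linear growth has finite cokernel -/
lemma coker_fd_gen {N : Type*} [AddCommGroup N] [Module K N] (f : N →ₗ[K] N)
    (hk : FiniteDimensional K (LinearMap.ker f))
    (G : ℕ → Submodule K N) (c e : ℕ) (hmono : Monotone G) (hfd : ∀ n, FiniteDimensional K (G n))
    (hdim : ∀ n, Module.finrank K (G n) ≤ c * (n + 1)) (hex : ∀ x, ∃ n, x ∈ G n)
    (hf : ∀ n, ∀ x ∈ G n, f x ∈ G (n + e)) :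
    FiniteDimensional K (N ⧸ LinearMap.range f) := by
  classical
  set k := Module.finrank K (LinearMap.ker f) with hkdef
  refine fd_of_card_le (k + c * e) fun s hs => ?_
  let π := (LinearMap.range f).mkQ
  have hsurj : Function.Surjective π := Submodule.mkQ_surjective _
  choose σ hσ using hsurj
  let z : s → N := fun i => σ i
  have hz : LinearIndependent K z := by
    refine LinearIndependent.of_comp π ?_
    have : (π ∘ z) = fun i : s => (i : N ⧸ LinearMap.range f) := funext fun i => hσ _
    rw [this]; exact hs
  let Z : Submodule K N := Submodule.span K (Set.range z)
  have hZfd : FiniteDimensional K Z := FiniteDimensional.span_of_finite K (Set.finite_range z)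
  have hZ : Module.finrank K Z = s.card := by
    rw [finrank_span_eq_card hz, Fintype.card_coe]
  have hdisj : Disjoint (LinearMap.range f) Z := by
    have h1 : LinearIndependent K (π ∘ z) := by
      have : (π ∘ z) = fun i : s => (i : N ⧸ LinearMap.range f) := funext fun i => hσ _
      rw [this]; exact hs
    have h2 := Submodule.range_ker_disjoint h1
    rw [Submodule.ker_mkQ] at h2
    exact h2.symm
  choose ν hν using hex
  let n0 := Finset.univ.sup fun i : s => ν (z i)
  have hZle : Z ≤ G n0 := by
    refine Submodule.span_le.2 ?_
    rintro _ ⟨i, rfl⟩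
    exact hmono (Finset.le_sup (f := fun i : s => ν (z i)) (Finset.mem_univ i)) (hν _)
  have key : ∀ n, n0 ≤ n → Module.finrank K (G n) + s.card ≤ Module.finrank K (G (n + e)) + k := by
    intro n hn
    have := hfd n
    have := hfd (n + e)
    let g : G n →ₗ[K] N := f.domRestrict (G n)
    have h1 := g.finrank_range_add_finrank_ker
    have h2 : Module.finrank K (LinearMap.ker g) ≤ k := by
      let φ : LinearMap.ker g →ₗ[K] LinearMap.ker f :=
        ((Submodule.subtype _).comp (Submodule.subtype _)).codRestrict _ (fun x => x.2)
      refine LinearMap.finrank_le_finrank_of_injective (f := φ) ?_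
      intro x y hxy
      have h : (φ x).1 = (φ y).1 := congrArg Subtype.val hxy
      exact Subtype.ext (Subtype.ext h)
    have h3 : Disjoint (LinearMap.range g) Z := hdisj.mono_left (by
      rintro _ ⟨x, rfl⟩
      exact ⟨x, rfl⟩)
    have h4 := Submodule.finrank_sup_add_finrank_inf_eq (LinearMap.range g) Z
    rw [h3.eq_bot, finrank_bot, hZ] at h4
    have h5 : LinearMap.range g ⊔ Z ≤ G (n + e) := by
      refine sup_le ?_ (hZle.trans (hmono (by omega)))
      rintro _ ⟨x, rfl⟩
      exact hf n x x.2
    have h6 := Submodule.finrank_mono h5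
    omega
  by_contra hcon
  push Not at hcon
  have iter : ∀ j : ℕ, j * (c * e + 1) ≤ Module.finrank K (G (n0 + j * e)) := by
    intro j
    induction j with
    | zero => simp
    | succ j ih =>
      have := key (n0 + j * e) (by omega)
      rw [show n0 + (j + 1) * e = n0 + j * e + e by ring]
      have : (j + 1) * (c * e + 1) = j * (c * e + 1) + (c * e + 1) := by ring
      omega
  have h1 := (iter (c * (n0 + 1) + 1)).trans (hdim _)
  nlinarith

namespace Ctx

lemma coker_simple (c : Ctx K D J H) [IsSimpleModule A M] (a : A) (ha : a ∉ FF K D J) :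
    FiniteDimensional K (M ⧸ LinearMap.range (ac K M a)) := by
  obtain ⟨G, C, hmono, hfd, hdim, hex, hst⟩ := c.lg (M := M)
  have he : ∃ e, ∀ n, ∀ x ∈ G n, a • x ∈ G (n + e) := by
    clear ha
    have ha : a ∈ Algebra.adjoin K {D, J, H} := by rw [c.gen]; trivial
    induction ha using Algebra.adjoin_induction with
    | mem x hx =>
      refine ⟨1, fun n y hy => ?_⟩
      rcases hx with rfl | rfl | rfl
      · exact (hst n y hy).1
      · exact (hst n y hy).2.1
      · exact (hst n y hy).2.2
    | algebraMap r =>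
      refine ⟨0, fun n y hy => ?_⟩
      rw [algebraMap_smul]; exact Submodule.smul_mem _ _ hy
    | add x y _ _ hx hy =>
      obtain ⟨e1, h1⟩ := hx
      obtain ⟨e2, h2⟩ := hy
      refine ⟨e1 + e2, fun n m hm => ?_⟩
      rw [add_smul]
      exact Submodule.add_mem _ (hmono (by omega) (h1 n m hm)) (hmono (by omega) (h2 n m hm))
    | mul x y _ _ hx hy =>
      obtain ⟨e1, h1⟩ := hx
      obtain ⟨e2, h2⟩ := hy
      refine ⟨e2 + e1, fun n m hm => ?_⟩
      rw [mul_smul, ← add_assoc]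
      exact h1 _ _ (h2 _ _ hm)
  obtain ⟨e, he⟩ := he
  exact coker_fd_gen (ac K M a) (c.ker_simple a ha) G C e hmono hfd hdim hex he

/-- ker and coker of extensions -/
lemma devissage (c : Ctx K D J H) (a : A) (ha : a ∉ FF K D J) {M : Type*} [AddCommGroup M]
    [Module A M] (hM : IsFiniteLength A M) : ∀ [Module K M] [IsScalarTower K A M],
    FiniteDimensional K (LinearMap.ker (ac K M a)) ∧
    FiniteDimensional K (M ⧸ LinearMap.range (ac K M a)) := by
  induction hM with
  | of_subsingleton =>
    intro _ _
    exact ⟨inferInstance, inferInstance⟩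
  | @of_simple_quotient M _ _ N hs hN ih =>
    intro _ _
    obtain ⟨i1, i2⟩ := ih
    have q1 := c.ker_simple (M := M ⧸ N) a ha
    have q2 := c.coker_simple (M := M ⧸ N) a ha
    constructor
    · let g : LinearMap.ker (ac K M a) →ₗ[K] LinearMap.ker (ac K (M ⧸ N) a) :=
        ((N.mkQ.restrictScalars K).comp (Submodule.subtype _)).codRestrict _ (fun x => by
          have hx : a • (x : M) = 0 := x.2
          change a • N.mkQ (x : M) = 0
          rw [← map_smul, hx, map_zero])
      have : FiniteDimensional K (LinearMap.ker g) := by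
        let φ : LinearMap.ker g →ₗ[K] LinearMap.ker (ac K N a) :=
          { toFun := fun x => ⟨⟨((x : LinearMap.ker (ac K M a)) : M), by
                have h : (g x).1 = 0 := congrArg Subtype.val x.2
                exact (Submodule.Quotient.mk_eq_zero N).1 h⟩, by
                have hx : a • ((x : LinearMap.ker (ac K M a)) : M) = 0 := x.1.2
                exact Subtype.ext hx⟩
            map_add' := fun x y => rfl
            map_smul' := fun r x => rfl }
        refine FiniteDimensional.of_injective φ ?_
        intro x y hxy
        have h : ((φ x).1 : M) = ((φ y).1 : M) := by rw [hxy]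
        exact Subtype.ext (Subtype.ext h)
      have : FiniteDimensional K (LinearMap.ker (ac K M a) ⧸ LinearMap.ker g) :=
        Module.Finite.equiv g.quotKerEquivRange.symm
      exact Module.Finite.of_submodule_quotient (LinearMap.ker g)
    · let g : (M ⧸ LinearMap.range (ac K M a)) →ₗ[K] (M ⧸ N) ⧸ LinearMap.range (ac K (M ⧸ N) a) :=
        Submodule.mapQ _ _ (N.mkQ.restrictScalars K) (by
          rintro _ ⟨x, rfl⟩
          exact ⟨N.mkQ x, (map_smul N.mkQ a x).symm⟩)
      let φ : (N ⧸ LinearMap.range (ac K N a)) →ₗ[K] (M ⧸ LinearMap.range (ac K M a)) :=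
        Submodule.mapQ _ _ (N.subtype.restrictScalars K) (by
          rintro _ ⟨x, rfl⟩
          exact ⟨x, rfl⟩)
      have hle : LinearMap.ker g ≤ LinearMap.range φ := by
        intro y hy
        obtain ⟨x, rfl⟩ := Submodule.mkQ_surjective _ y
        have h1 : (LinearMap.range (ac K (M ⧸ N) a)).mkQ (N.mkQ x) = 0 := hy
        obtain ⟨w, hw⟩ := (Submodule.Quotient.mk_eq_zero _).1 h1
        obtain ⟨u, rfl⟩ := Submodule.mkQ_surjective _ w
        have hw' : N.mkQ (x - a • u) = 0 := by
          rw [map_sub, map_smul, sub_eq_zero]; exact hw.symm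
        have hmem : x - a • u ∈ N := (Submodule.Quotient.mk_eq_zero N).1 hw'
        refine ⟨Submodule.mkQ _ ⟨x - a • u, hmem⟩, ?_⟩
        change (LinearMap.range (ac K M a)).mkQ (x - a • u) = (LinearMap.range (ac K M a)).mkQ x
        rw [map_sub, sub_eq_self]
        exact (Submodule.Quotient.mk_eq_zero _).2 ⟨u, rfl⟩
      have : FiniteDimensional K (LinearMap.ker g) := Submodule.finiteDimensional_of_le hle
      have : FiniteDimensional K ((M ⧸ LinearMap.range (ac K M a)) ⧸ LinearMap.ker g) :=
        Module.Finite.equiv g.quotKerEquivRange.symm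
      exact Module.Finite.of_submodule_quotient (LinearMap.ker g)

lemma simple_inf (c : Ctx K D J H) [IsSimpleModule A M] : ¬ FiniteDimensional K M := by
  intro h
  have := IsSimpleModule.nontrivial A M
  exact top_ne_bot (c.inf (⊤ : Submodule K M) (fun _ _ => trivial) (fun _ _ => trivial))

lemma ker_inf (c : Ctx K D J H) (hM : IsFiniteLength A M) [Nontrivial M] (a : A)
    (ha : a ∈ FF K D J) : ¬ FiniteDimensional K (LinearMap.ker (ac K M a)) := by
  intro h
  obtain ⟨_, _⟩ := isFiniteLength_iff_isNoetherian_isArtinian.1 hM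
  obtain ⟨S, hS⟩ := IsAtomic.exists_atom (Submodule A M)
  have hs : IsSimpleModule A S := isSimpleModule_iff_isAtom.2 hS
  have := c.FF_range (M := S) a ha
  refine c.simple_inf (M := S) ?_
  have : FiniteDimensional K (LinearMap.ker (ac K S a)) := by
    let φ : LinearMap.ker (ac K S a) →ₗ[K] LinearMap.ker (ac K M a) :=
      ((S.subtype.restrictScalars K).comp (Submodule.subtype _)).codRestrict _ (fun x =>
        congrArg (Subtype.val : S → M) x.2)
    refine FiniteDimensional.of_injective φ ?_
    intro x y hxy
    have h : (φ x).1 = (φ y).1 := congrArg Subtype.val hxy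
    exact Subtype.ext (Subtype.ext h)
  have : FiniteDimensional K (S ⧸ LinearMap.ker (ac K S a)) :=
    Module.Finite.equiv (ac K S a).quotKerEquivRange.symm
  exact Module.Finite.of_submodule_quotient (LinearMap.ker (ac K S a))

lemma coker_inf (c : Ctx K D J H) (hM : IsFiniteLength A M) [Nontrivial M] (a : A)
    (ha : a ∈ FF K D J) : ¬ FiniteDimensional K (M ⧸ LinearMap.range (ac K M a)) := by
  intro h
  obtain ⟨_, _⟩ := isFiniteLength_iff_isNoetherian_isArtinian.1 hM
  obtain ⟨N, hN⟩ := IsCoatomic.exists_coatom (Submodule A M)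
  have hs : IsSimpleModule A (M ⧸ N) := isSimpleModule_iff_isCoatom.2 hN
  have := c.FF_range (M := M ⧸ N) a ha
  refine c.simple_inf (M := M ⧸ N) ?_
  let g : (M ⧸ LinearMap.range (ac K M a)) →ₗ[K] (M ⧸ N) ⧸ LinearMap.range (ac K (M ⧸ N) a) :=
    Submodule.mapQ _ _ (N.mkQ.restrictScalars K) (by
      rintro _ ⟨x, rfl⟩
      exact ⟨N.mkQ x, (map_smul N.mkQ a x).symm⟩)
  have : FiniteDimensional K ((M ⧸ N) ⧸ LinearMap.range (ac K (M ⧸ N) a)) := by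
    refine Module.Finite.of_surjective g ?_
    intro y
    obtain ⟨w, rfl⟩ := Submodule.mkQ_surjective _ y
    obtain ⟨u, rfl⟩ := Submodule.mkQ_surjective _ w
    exact ⟨Submodule.mkQ _ u, rfl⟩
  exact Module.Finite.of_submodule_quotient (LinearMap.range (ac K (M ⧸ N) a))

end Ctx
end Abstract

section Concrete

lemma intOp_monomial (n : ℕ) (r : K) :
    intOp K (monomial n r) = monomial (n + 1) (((n : K) + 1)⁻¹ * r) := by
  rw [intOp, Polynomial.lsum_apply, Polynomial.sum_monomial_index]
  · simp [smul_monomial]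
  · simp

lemma derOp_monomial (n : ℕ) (r : K) :
    derOp K (monomial n r) = monomial (n - 1) (r * n) := by
  simp [derOp, derivative_monomial]

lemma xOp_monomial (n : ℕ) (r : K) : xOp K (monomial n r) = monomial (n + 1) r := by
  simp [xOp, X_mul_monomial]

lemma Hop_monomial (n : ℕ) (r : K) : Hop K (monomial n r) = monomial n (r * ((n : K) + 1)) := by
  rw [Hop, Module.End.mul_apply, xOp_monomial, derOp_monomial]
  simp

lemma end_ext {f g : Module.End K K[X]} (h : ∀ n (r : K), f (monomial n r) = g (monomial n r)) :
    f = g := by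
  refine Polynomial.lhom_ext' fun n => ?_
  exact LinearMap.ext fun r => h n r

lemma op_DJ : derOp K * intOp K = 1 := by
  refine end_ext K fun n r => ?_
  have : (n : K) + 1 ≠ 0 := Nat.cast_add_one_ne_zero n
  simp only [Module.End.mul_apply, intOp_monomial, derOp_monomial, Module.End.one_apply]
  congr 1
  push_cast
  field_simp

lemma op_HJ : Hop K * intOp K = intOp K * Hop K + intOp K := by
  refine end_ext K fun n r => ?_
  have : (n : K) + 1 ≠ 0 := Nat.cast_add_one_ne_zero n
  simp only [Module.End.mul_apply, LinearMap.add_apply, intOp_monomial, Hop_monomial, ← map_add]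
  congr 1
  push_cast
  field_simp

lemma op_DH : derOp K * Hop K = Hop K * derOp K + derOp K := by
  refine end_ext K fun n r => ?_
  simp only [Module.End.mul_apply, LinearMap.add_apply, derOp_monomial, Hop_monomial, ← map_add]
  congr 1
  rcases n with _ | n
  · simp
  · push_cast
    ring

lemma op_E : Hop K * (1 - intOp K * derOp K) = 1 - intOp K * derOp K := by
  refine end_ext K fun n r => ?_
  have : (n : K) + 1 ≠ 0 := Nat.cast_add_one_ne_zero n
  simp only [Module.End.mul_apply, LinearMap.sub_apply, Module.End.one_apply, derOp_monomial,
    intOp_monomial, map_sub, Hop_monomial]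
  rcases n with _ | n
  · simp
  · have : (n : K) + 1 ≠ 0 := Nat.cast_add_one_ne_zero n
    have e : ((n : K) + 1)⁻¹ * (r * ((n : K) + 1)) = r := by field_simp
    simp [e]

lemma op_X : xOp K = intOp K * Hop K := by
  refine end_ext K fun n r => ?_
  have : (n : K) + 1 ≠ 0 := Nat.cast_add_one_ne_zero n
  simp only [Module.End.mul_apply, xOp_monomial, intOp_monomial, Hop_monomial]
  congr 1
  field_simp

lemma I1_ctx : Ctx K (DelI K) (IntI K) (HelI K) where
  hDJ := Subtype.ext (op_DJ K)
  hHJ := Subtype.ext (op_HJ K)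
  hDH := Subtype.ext (op_DH K)
  hE := Subtype.ext (op_E K)
  gen := by
    have hle : I1 K ≤ (Algebra.adjoin K {DelI K, IntI K, HelI K}).map (I1 K).val := by
      refine Algebra.adjoin_le_iff.2 ?_
      have hD : derOp K ∈ (Algebra.adjoin K {DelI K, IntI K, HelI K}).map (I1 K).val :=
        ⟨DelI K, Algebra.subset_adjoin (by simp), rfl⟩
      have hJ : intOp K ∈ (Algebra.adjoin K {DelI K, IntI K, HelI K}).map (I1 K).val :=
        ⟨IntI K, Algebra.subset_adjoin (by simp), rfl⟩
      have hH : Hop K ∈ (Algebra.adjoin K {DelI K, IntI K, HelI K}).map (I1 K).val :=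
        ⟨HelI K, Algebra.subset_adjoin (by simp), rfl⟩
      rintro _ (rfl | rfl | rfl)
      · rw [op_X]; exact mul_mem hJ hH
      · exact hD
      · exact hJ
    rw [eq_top_iff]
    rintro a -
    obtain ⟨b, hb, hab⟩ := hle a.2
    have : b = a := Subtype.ext hab
    rw [← this]; exact hb

lemma mem_FF_iff (a : I1 K) :
    a ∈ FF K (DelI K) (IntI K) ↔ (a : Module.End K (Polynomial K)) ∈ Fspan K := by
  have hmap : (FF K (DelI K) (IntI K)).map (I1 K).val.toLinearMap = Fspan K := by
    rw [FF, Submodule.map_span, Fspan]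
    congr 1
    have he : ∀ i j : ℕ, (I1 K).val.toLinearMap
        (IntI K ^ i * (1 - IntI K * DelI K) * DelI K ^ j) = eOp K i j := by
      intro i j
      change intOp K ^ i * (1 - intOp K * derOp K) * derOp K ^ j = _
      rw [eOp, pow_succ, pow_succ']
      simp only [mul_sub, sub_mul, mul_one, mul_assoc]
    ext x
    constructor
    · rintro ⟨_, ⟨p, rfl⟩, rfl⟩
      exact ⟨p, (he _ _).symm⟩
    · rintro ⟨p, rfl⟩
      exact ⟨_, ⟨p, rfl⟩, he _ _⟩
  rw [← hmap]
  constructor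
  · exact fun h => ⟨a, h, rfl⟩
  · rintro ⟨b, hb, hab⟩
    have : b = a := Subtype.ext hab
    rw [← this]; exact hb

lemma actMap_eq (M : Type*) [AddCommGroup M] [Module K M] [Module (I1 K) M]
    [IsScalarTower K (I1 K) M] (a : I1 K) : actMap K M a = ac K M a := rfl

end Concrete

/-- For a nonzero left `I₁`-module `M` of finite length and `a ∈ I₁`,
the kernel of `a_M : m ↦ a•m` is finite-dimensional over `K` iff `a ∉ F`, and the
cokernel of `a_M` is finite-dimensional over `K` iff `a ∉ F`. -/
theorem ker_coker_finiteDimensional_iff_not_mem_F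
    (M : Type*) [AddCommGroup M] [Module K M] [Module (I1 K) M]
    [IsScalarTower K (I1 K) M] [Nontrivial M]
    (hM : IsFiniteLength (I1 K) M) (a : I1 K) :
    (FiniteDimensional K (LinearMap.ker (actMap K M a)) ↔
        (a : Module.End K (Polynomial K)) ∉ Fspan K) ∧
    (FiniteDimensional K (M ⧸ LinearMap.range (actMap K M a)) ↔
        (a : Module.End K (Polynomial K)) ∉ Fspan K) := by
  have c := I1_ctx K
  rw [actMap_eq, ← mem_FF_iff]
  exact ⟨⟨fun h ha => c.ker_inf hM a ha h, fun ha => (c.devissage a ha hM).1⟩,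
    ⟨fun h ha => c.coker_inf hM a ha h, fun ha => (c.devissage a ha hM).2⟩⟩

end
end
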